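/- arXiv:1602.06607 — 2 statements merged into one kernel-verified Lean document; each statement's English description precedes it below -/
import Mathlib

section
/- Let (n,d) = (4,6). Both index sets I_{(n/2)d−n−2} = I_6 and I_d = I_6 have 426 elements, so the period matrix of any p : I_{(n/2+1)d−n−2} = I_{12} → ℂ is a 426×426 square matrix. There exist integers c_{a,b}, indexed by the pairs (a,b) with a ∈ {0,…,5}^3 and b a permutation of {0,…,5}, such that the period matrix of p := Σ_{(a,b)} c_{a,b}·p^{a,b} is invertible; consequently, the set of complex coefficient tuples (c_{a,b}) for which the period matrix of Σ c_{a,b}·p^{a,b} is singular is the zero locus of a nonzero polynomial, so a general ℤ-linear combination of the period vectors of the linear cycles ℙ² of the Fermat sextic fourfold has invertible period matrix. -/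
open Finset Matrix

/-- `ζ_{2d} = exp(2πi/(2d))`. -/
noncomputable def zeta2d (d : ℕ) : ℂ :=
  Complex.exp (2 * Real.pi * Complex.I / (2 * (d : ℂ)))

/-- The even-position index `2e` in `{0,…,n+1}` (with `n = 2h`). -/
def evIdx (h : ℕ) (e : Fin (h + 1)) : Fin (2 * h + 2) :=
  ⟨2 * e.1, by have := e.isLt; omega⟩

/-- The odd-position index `2e+1` in `{0,…,n+1}` (with `n = 2h`). -/
def odIdx (h : ℕ) (e : Fin (h + 1)) : Fin (2 * h + 2) :=
  ⟨2 * e.1 + 1, by have := e.isLt; omega⟩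

/-- The index set `I_N`: tuples `(i_0,…,i_{n+1})` with `0 ≤ i_e ≤ d-2` and `∑ i_e = N`,
for `n = 2h` even. -/
abbrev IdxSet (h d N : ℕ) : Type :=
  {i : Fin (2 * h + 2) → Fin (d - 1) // ∑ e, (i e).1 = N}

/-- The period vector `p^{a,b}` of the linear cycle `ℙ^{n/2}_{a,b}` in the Fermat variety,
extended by zero to all integer tuples. -/
noncomputable def pvec (h d : ℕ) (a : Fin (h + 1) → ℕ) (b : Equiv.Perm (Fin (2 * h + 2)))
    (i : Fin (2 * h + 2) → ℕ) : ℂ :=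
  if ∀ e : Fin (h + 1), i (b (evIdx h e)) + i (b (odIdx h e)) = d - 2 then
    zeta2d d ^ (∑ e : Fin (h + 1), (i (b (evIdx h e)) + 1) * (1 + 2 * a e))
  else 0

/-- The period matrix `[p_{i+j}]` with rows indexed by `I_{(n/2)d-n-2}` and columns by `I_d`. -/
noncomputable def pmat (h d : ℕ) (p : (Fin (2 * h + 2) → ℕ) → ℂ) :
    Matrix (IdxSet h d (h * d - (2 * h + 2))) (IdxSet h d d) ℂ :=
  Matrix.of fun i j => p fun e => (i.1 e).1 + (j.1 e).1

/-- The period vector `P` of the linear cycle with `a = (0,…,0)` and `b = id`. -/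
noncomputable def Pvec (h d : ℕ) : (Fin (2 * h + 2) → ℕ) → ℂ :=
  pvec h d (fun _ => 0) (Equiv.refl _)

/-- The period vector `P̌_m` (with `μ = m+1`): `a` has first `μ` entries `0`, the rest `1`,
and `b = id`. -/
noncomputable def PcheckVec (h d μ : ℕ) : (Fin (2 * h + 2) → ℕ) → ℂ :=
  pvec h d (fun e => if e.1 < μ then 0 else 1) (Equiv.refl _)

/-- The combinatorial constant `C_{α_1,…,α_s}`. -/
def Ccoef (n d : ℕ) {s : ℕ} (α : Fin s → ℕ) : ℤ :=
  ((n + 1 + d).choose (n + 1) : ℤ) -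
    ∑ k ∈ Finset.Icc 1 s, (-1 : ℤ) ^ (k - 1) *
      ∑ T ∈ Finset.univ.filter (fun T : Finset (Fin s) => T.card = k ∧ ∑ i ∈ T, α i ≤ d),
        (((n + 1 + d - ∑ i ∈ T, α i).choose (n + 1) : ℤ))

/-- The sequence `x^s, y^t` (x repeated s times followed by y repeated t times). -/
def twoBlock (x y s t : ℕ) : Fin (s + t) → ℕ := fun i => if i.1 < s then x else y

/-- `K^d_n(m) = 2·C_{1^{n/2+1},(d-1)^{n/2+1}} − C_{1^{n−m+1},(d−1)^{m+1}}`, with `n = 2h`,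
`μ = m+1`. -/
def Kdef (h d μ : ℕ) : ℤ :=
  2 * Ccoef (2 * h) d (twoBlock 1 (d - 1) (h + 1) (h + 1)) -
    Ccoef (2 * h) d (twoBlock 1 (d - 1) (2 * h + 2 - μ) μ)


/-! ### An explicit inverse over `ZMod 2` -/

namespace SexticAux

/-- Six natural numbers. -/
abbrev Tup := ℕ × ℕ × ℕ × ℕ × ℕ × ℕ

/-- The exponents `s` at which the chosen period vector is `1`, each with a permutation `b`
that groups the entries of `s` into three pairs of sum `4`. -/
def tdata : List (Tup × Tup) :=
  [((0, 0, 4, 4, 4, 0), (0, 2, 1, 3, 4, 5)),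
   ((0, 1, 0, 3, 4, 4), (0, 4, 1, 3, 2, 5)),
   ((0, 1, 2, 3, 2, 4), (0, 5, 1, 3, 2, 4)),
   ((0, 2, 2, 0, 4, 4), (0, 4, 1, 2, 3, 5)),
   ((0, 2, 4, 1, 3, 2), (0, 2, 1, 5, 3, 4)),
   ((0, 2, 4, 2, 1, 3), (0, 2, 1, 3, 4, 5)),
   ((0, 4, 2, 1, 3, 2), (0, 1, 2, 5, 3, 4)),
   ((0, 4, 4, 0, 4, 0), (0, 1, 2, 3, 4, 5)),
   ((1, 0, 2, 3, 4, 2), (0, 3, 1, 4, 2, 5)),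
   ((1, 2, 4, 0, 2, 3), (0, 5, 1, 4, 2, 3)),
   ((1, 2, 4, 0, 3, 2), (0, 4, 1, 5, 2, 3)),
   ((1, 3, 0, 2, 4, 2), (0, 1, 2, 4, 3, 5)),
   ((1, 3, 4, 0, 3, 1), (0, 1, 2, 3, 4, 5)),
   ((1, 3, 4, 3, 0, 1), (0, 1, 2, 4, 3, 5)),
   ((1, 4, 4, 0, 3, 0), (0, 4, 1, 3, 2, 5)),
   ((2, 0, 4, 4, 2, 0), (0, 4, 1, 2, 3, 5)),
   ((2, 1, 0, 3, 4, 2), (0, 5, 1, 3, 2, 4)),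
   ((2, 1, 3, 2, 4, 0), (0, 3, 1, 2, 4, 5)),
   ((2, 2, 1, 4, 0, 3), (0, 1, 2, 5, 3, 4)),
   ((2, 2, 2, 1, 2, 3), (0, 1, 2, 4, 3, 5)),
   ((2, 2, 2, 2, 3, 1), (0, 1, 2, 3, 4, 5)),
   ((2, 2, 3, 1, 2, 2), (0, 1, 2, 3, 4, 5)),
   ((2, 2, 3, 4, 0, 1), (0, 1, 2, 5, 3, 4)),
   ((2, 3, 1, 3, 2, 1), (0, 4, 1, 2, 3, 5)),
   ((2, 3, 2, 4, 1, 0), (0, 2, 1, 4, 3, 5)),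
   ((2, 3, 4, 0, 1, 2), (0, 5, 1, 4, 2, 3)),
   ((2, 4, 0, 3, 1, 2), (0, 5, 1, 2, 3, 4)),
   ((2, 4, 2, 4, 0, 0), (0, 2, 1, 4, 3, 5)),
   ((3, 0, 0, 4, 4, 1), (0, 5, 1, 3, 2, 4)),
   ((3, 1, 1, 3, 0, 4), (0, 1, 2, 3, 4, 5)),
   ((3, 1, 2, 2, 2, 2), (0, 1, 2, 3, 4, 5)),
   ((3, 1, 2, 3, 1, 2), (0, 1, 2, 5, 3, 4)),
   ((3, 2, 2, 0, 4, 1), (0, 5, 1, 2, 3, 4)),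
   ((3, 3, 1, 1, 3, 1), (0, 2, 1, 3, 4, 5)),
   ((4, 0, 0, 3, 1, 4), (0, 1, 2, 5, 3, 4)),
   ((4, 0, 1, 3, 2, 2), (0, 1, 2, 3, 4, 5)),
   ((4, 0, 3, 2, 1, 2), (0, 1, 2, 4, 3, 5)),
   ((4, 0, 4, 0, 4, 0), (0, 1, 2, 3, 4, 5)),
   ((4, 1, 3, 2, 2, 0), (0, 5, 1, 2, 3, 4)),
   ((4, 1, 4, 3, 0, 0), (0, 4, 1, 3, 2, 5)),
   ((4, 2, 0, 3, 2, 1), (0, 2, 1, 4, 3, 5)),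
   ((4, 2, 2, 2, 2, 0), (0, 5, 1, 2, 3, 4)),
   ((4, 3, 0, 1, 2, 2), (0, 2, 1, 3, 4, 5)),
   ((4, 3, 2, 1, 0, 2), (0, 4, 1, 3, 2, 5)),
   ((4, 4, 0, 1, 0, 3), (0, 2, 1, 4, 3, 5))]

/-- The rows of the inverse matrix over `ZMod 2`, as bit masks. -/
def invRows : List ℕ :=
  [112162845351883132381035505043126809860676546670048882591373335553515416643967305559924007782508432652197994388995241890669836370,
   108089465344683004325454343389188322671929264965193161602601836863078886060544866345674675760033510856080737583006139476031807613,
   41077771926184216566047319305505016288657470941900194504766425924615062657343963288823088164035608728790652573187379520731262338,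
   55268986872422266054868057661494095282978740786929940462859021701626436037032482422171397505710028433018476810733176916338254210,
   133884111141837679672770900730207519073873601998126465521940550926293398832913328477960300252172420988950074770916690296493666483,
   149883590592165085828181313340934795300217557494653819889378274403074800384110984185499408503460473747313857408190075086134588530,
   50639985518863948742837746227189524466589384162757948560534441124630564725431613055640105636829363438877432005960131402058994979,
   41702043182722400408278887355687161166642862917914828164901660342535013960859066949631757359115071667397319720659205793703646364,
   93588630632213118911803754542789508578881827823568921739605793678855626034646247074466977446560024750130851535786233974241866828,
   332306998946228968225951765070086144,
   162431878781715497148715010829401223566606498461794359645885748379921096660977732231141067167217397769475853985306623006574927332,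
   158919060522984247688461005166971583008588198262808121268331359630622570804158871321978673979616767099876062102774446719996556293,
   96872759471765079093323327549953349166895318645117409129451153443139617421794122189388546591215086582303823359057611421396585969,
   139132877326531420087629497825303143999701692934825403047697862266047237188819704070662595179112069473450822357857129344061778239,
   156360122278138244890542226181529002172959286537069185150869261163196433062535227959866896713668512925272338983237206117196422288,
   41612209939570066590391880269669603026004738102248458148432660022706853126704792931496796881097140464476732486097895017700024783,
   2049392775252906025010823167532309312022808600165144987195300977423243426762830707600614787791163773585592586978934215965684122,
   155907542362611260118694941971175539783692109400938172807821500094030746079060212644578125578825141083886586630977993479973552399,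
   47245953715768002595194918784134911519507181601593702595363619598438668149507681773855061145256155593074001431187782389506332851,
   1231312693637327475383720003129487931408741852202045208373384168882678805359287831606695820465153613775207124697088,
   61783139621865150114273068922551035147067379897758132551931913546121247868501750379542878751517582108246534603583227879301200054,
   29264837980517568243701878468464493513881228915981413062713381271489094421201834312823350953579555135261849911522755768350710244,
   168977154958743199125406321519164615651153006949977030542818160196901577316257819160365851192077182103298359543875753418304937291,
   44277519114955563421797237855769031660049857791971403051356404258594927515154970718112180145403998638004574799632442408804201789,
   22773361707470087776395395960074911472319440351943233080828856953722457171185928658016852293845862048089143398099462338853026030,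
   111253793289555571002241101203186004279966887457294698750708753238174822800384239101587232866603744563555613709051752960225663414,
   5938513830590876164202006006996902126782462371970108019361305613770241596922270298267914081453193362339042536777259904099885274,
   84578354652180487988822442082303784164510470278043906682582420544882171141363700496138406924849639481355151041776383555320179988,
   162776828498595598261615795398368139649073941032516168899585973111910262319770258764202809333060097282047347355131230097642931586,
   151929766033092004820522906953011417096323473218017011164265149518864195629391813579494565340690810137356627947083421222382781469,
   47245788451775805033045180805307903326747224500422961525058798436239849548059872696018604847953545664252789533384776133666756787,
   95237125046378483843859217355343077646212961560353256137623427169258492962439752529096134220440566406809780046038795611986675055,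
   81956390477482827801345203683220473027791707484725089007175554025868158997714517153202314512559128942670935302376939518792433055,
   153905224694416945965977119525692607135287279553714612774595019034832862325070759663626077921291213648504556341703809638652329052,
   122950617433102384347295713883185689067565043736324165259564667670536366120474539344046142608438117531450929730593824283594922213,
   34296799322188082662089167060684722506822437180346443054606061569904115397769574171340928622278536663940885728028244670642824611,
   5997713498176377808760694495665467471636831200789498351722465099618786545811987526650512499222461296923742467401614588562054326,
   170105650896293138940722841474985636302461811533634430165981220523445746251821646322522478324782052856764713458429500685315156342,
   79704985777097623937581922826128940313006150780165934710129502392296605237328417041634446606989990312005607242936332511924922467,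
   143402195295512157319037035029871481352865243806261753043317913835394614725622657940416298592173365590458992729551184321304488128,
   92370737186948585838792942476207116730359476777294365704803778204477340790187325528280288263189295591555593560539435414640972171,
   157592637896147232608025079453608783005174742369104381916420847699220825185084246985401482086422433801821597761740721974776592571,
   106242684690301853684790432732526405070858747342926344940371505511508574779993246624802071664618302955675086596393654755271947386,
   1122799646131998966323448499284546144722107722474180820038949313910547638444479107311674263672791031739301495784767789023388076,
   166773473148425569543941063692816681427190853304989582706719753763857528452557941154487831277128335477883309058875386403964316057,
   18381866979060677716866480206252566597834992489268326462076440212304801263960179332473632893681509659564779328725071055349158175,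
   168752373804208524034681010626820105810501824439651441550316961535875330424678918050074922285113785800563061529101068142853168407,
   40090852818676967430761225697027082153747810310692312880548823828072064391959338467013610547139464106533908236398946611971219562,
   161704357358786793945658559573437825535385858437939228682923100855809187749170749336250477864641841595605354154099284840426146150,
   166232565987455801963281358458209720933797001301583356397542433495885286547815215579170368312345196032078909889060222962760912123,
   68590496012890407878282355409306338457251035905042187080702564705935363405173078197350100200438695461342607379565266905404215682,
   75469008879461725015330532699068512312280954421641336434686920920222629867085066649016495643242094979457165000683497614473334916,
   5415370496329716522614090203404460358274291162843391748379842930887932241807862544999950011922147613471467208908991351228465152,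
   42307582002575910332922579714097346549017899709713998034217522897561970639123926132812109468141778230245837569601494931472384,
   146590817883858552114811716616687297030060372132750193044131426062405666525037155200521116276760922421159758525394455219037964372,
   119898900305119250241991442460086669309114459068099170530340309354933199297169819700471792463360414666462181399099604189370912004,
   10576895500643977583230644928524336637254474927428499508554380724390492659780981533203027367035444557561459392400373732868096,
   27527155568877015016836842456166088540545305600385739769983443253606869655095376382626841163510181225899433167963802655704601740,
   45629942383044762129597473694212382754133823272505726490989997069903105931373996312204510578240639037329199830452001872006332478,
   77370496112175284056949794256130736267948693463137432933292313835553842300092828281810745720624731971758846879305024208859700533,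
   140296919979857238790710873980326098723713975879850595130936788190963304247335412474099749196852029098025369542382364815922701622,
   166767776692392051470842360576618500947239769607985258198361702834997507799113037950885139897892486315076337759693362284255577386,
   148509318265061095001237715651527605415968168526501615748759447123761390864670935902906938871064099952718762148221563968167387352,
   36905760033627684064925706669978640000445429762889164628211068925314533053510415473904567273981999544018867958984097622841094441,
   107117475098430062600575596858655797539218097612178073755020668058071929848763404168026692833422849937962410520588369580982904220,
   22469170843465078818659826601913318221755315274089041524908233324553679232028669765191760110201135801462518956081032952134289916,
   152225974272168230339732208368743639570191270772184927246208512867966427503394799616349940908864177081434051673900841966069297152,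
   66808681678078286810214364262257833458048888480556875933893612266516081187290074472190800243382366844364561342027100703348430037,
   33693135992446287000803207508798365058002007650558913830049525509150807274888185265327584166434024658698162038409480850865509846,
   7244701048263031812087644292061098459571574094373637017474597342979124662581408002422860130852537046975632618747976036921092289,
   13318696170174303823748255703917577142619624169003067176592243425978529739918700324842156914891407898293433493870578296211091782,
   156488941361924092726761857368919131621902282880059553139082123901258002922405748405393935956065503670457851235675240223550510192,
   42140369535885997194868576267489796010587794375054383822597738402039599690354479483548275286923243359166637548253534099467588690,
   128201201675222010098726375670430871598989617081478762831789343606482279400010318169379666005624724461120847072003376234279138686,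
   147818980060888386060624236601301904794061470958165415119129978496066265200478125795737176148112487091040887278405502819272807899,
   172851890324215818970303127934249292875393785609941092160112415966730748958232031810808531832327686709311328087084173169059564782,
   124979353857611428197939079378579624236544781808712055785102866312308086303028631941716669072744229790712073737549421058628681995,
   101244337494427854789294043268399282369689860268569425352256101988793590074095913103943077406072676997937855204607846402457243719,
   100026935402064281967484239470047615260608512231185653790293645603054842354421372051230145283197151779518651815861150259644637653,
   78937835102594094749825383083143903020095854082630164789010380413771299965397142527406261724814044920847507166334284544287900018,
   128870937863208174669008969915007602008362356751878348286960696607158314005142152761592073078040986205864350557384363255920635039,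
   170822333993468491554421242839501160220172157717975608560924310260611483092232218914119179874351487458394607029504938437896371662,
   169483262168663359473000866286365192430826191258498906300080450824912977978041986361778180942212574470214974786883482347893817779,
   105538596576407295557606765257753683721911684459782258777927184803980031688796071241692666275912730585509966766603476082807394801,
   7405145671876654471814287062542398145703416864319428856570629486634344463209908497685076551683229048258681705316928932797340100,
   124457590710840544129258966593993897853676765513130063838890117808752036920223837998847153767431307780690728980679555092776634743,
   41812711808664717063928406551640574574514453522244775972681347467043636521957654390890783271522109116720416375549871603949208702,
   110955454462922037985618252794179906114953605767073911094345437433969839148138298275731403474863371952827154101590806538397710445,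
   152199640649318907147055598262866291120788806825328025747176049882251839202343648944947129924313746061414270081224230467390424216,
   29118232102445632399165154452843284711574850321435980831152325057644940861633641024065877170868321995730218639719488217574340670,
   116609137782189602575031923153157115492215073393873292431885097510424839142576188819948928520811836877563463181314397456737309967,
   94830218050192438828149927531525470975537701109681971244314645420669370414025218213688705298581735892970426173682333898359776405,
   39696398866758003646245986695935624925851291040531344679979932988112825655982358386345010531152385041432512749931909405020889126,
   105538595285282356514152470429794097720405747294929362363315428388650353418472260233272068961090053945441051048651890096433648113,
   69642298432121553978968707309987155611997921101807819546423374903391117336853383162569581617061137166955082449016894546467257638,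
   131302604109989994036455519067065251924480435645249878762016310065871109536908703659215282620258753912804390771679188936177349676,
   124457590388059309368395392887004001353300281221916839735237178704919617352642885246742004438725638620673500051191658596183198071,
   129945929964235132654127245789949777167909439214839331617219158480929468698283087260990876792867335316284928518344286998803924394,
   162648344971566544825191555578960048307721581493574292350169115325289034132071933526044070557214376376594903716748500729611961772,
   33257031579428869890100195279005294286378339867674325082085702798869830846984206317063594944677294036801765907733965095752216855,
   93912275676984066595491201092580676012102967009580237580576125949198999344933270109861096557857754051823670465072961416303191190,
   784338990111391683660067861571767372329964524796468835765209130730051873331487698249177387927656805897334795227955829571609004,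
   5061604065475939651057873429354596819936162883316369682458689765834999932112954238452985150714488461416088085740305373153456416,
   92409371657162768592735503340983977400171352836661365377146085348740462219865359112345721590968410073124947154197188658188025193,
   12934215969917485655046065103615541484244786369263808109993827157761195217732682154413235079298843816834729430224058316365286595,
   28898329816829571501560796438199654700084153066844063819046760755872366846059984526088368388379591995717628976477536093957633222,
   96211593262804658925216516489894794631376514248436172759018641872299039006209160779946158951320603546204348144022140857672287310,
   158728113982614752684807418333922987523843008810923715006199704708687850864175936544007661408102908721061423076313768324099159477,
   131657012488867224594011756730735967042000785028150047116232179071052494959369154122674502038699394939386212801526515976746782925,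
   34109500502647142594458507117153888093279119460572049519106118586966578390652749578802866308982084230327972056376608368344996881,
   130468149614568394364819296038882467784570558762117637814952896356274248815444341300474733602591150807472520974359861612068831510,
   27521867121126693028045227133701826372226678362922025520229166063244674408765485891860239649826663503620652438267602468838167692,
   27744774898991075186364311189091180241793576091926270358684670614627890821363747512874241679879426825626710290740914347487669568,
   22256261468892607976173949396384022243842667793619109866692537448941804184292176862442764679134815110799475761771696733201455125,
   24620520935461812090111800677624443634451438369667481143093499387155755967025069025464283045126215704419562377943169562958932019,
   128402667709591500501691916823449731968414269152282150237403050624543965320065866988392366020594798050658719072620517834061031776,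
   85409714006417614994463528277623201060527012065018079886350290872697245358009814892975480328475767192565224539202102735498885424,
   4867083523009402633058092853050747809989028041715082268553219903291756294000742473198626251569423943658739396241478413115791543,
   150575273460007821872373391829602783437486184843964793595715095710421901141795842857625276801977000387794158646142501496405689046,
   8061786085235350733084681328754102951811046079625616064364220636868938836401775466249348416883537672765292178250352549204302037,
   7142736818569173434766450504227341204774447095176868555342768789505271370365023091822305881106491235607752397665913887092331641,
   153675748811494391647090762799537987915917134535284481793592590041796189018933250942762054342299196347186159124492413184059612527,
   57912605315414260376095009804626944330631664109541337014168954556230140265025119631746540584978210298385387646799701952882036770,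
   65507431843584932877015121097690609414060696418151649262732905042406745480946617651951611361260271184559822519944532231799884980,
   60100792896293685152705953223699722047762254095649145230992611659078098724438572979335609215566611807719020092312559852594870557,
   96395076730206923538513240480155829747386890706704498776909860452693554399778456532867914386237097284745155623615652468098147466,
   25852138173367226860398302262920825360302615101763655781250791519330582341047454665131250415875689641063432460522796355750539626,
   158728113982535948672414629375498429443642721583313555527658773815351954277367445100464666986880080188551653245032155068118545845,
   94940087457612650634917138229007791260273275465956481849943042028560071111262743356726877028385586036035359785306521664842936433,
   31841896870859904673799123352755229343583163270351073121182471453712095450547870380016293147076856667622840120254388897760746692,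
   21208614507630601168372892439987885174714420453257835897080791362082754466626635951561662133875658410936218705179883827989932336,
   15680017188495891477294923931311810442584761781216132782168004014946809420188365457867441282614512335998749234502086628048404861,
   83197558949081575514849545053007171898187334984877096832821131542734533406096193818556981137130490998271673626859405697628687596,
   1326109271461177956283649655786010458208200757241152238100162242895223160770498173639352552273052792310232526498689806984382865,
   5359850323924495687716296250545570623655093334474186092920093830409995067744757317902665520262849201496618653938798312686708177,
   102332801760828917462668290238457797896287589440257890351302749005147108511014231095375447783511215375589278704526086464008720791,
   160653444670857757211001451105453078780634988047631201067937981079528216625628473635554973779291174408846341894056137205702831482,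
   15680017188515592480393121170917949962634833588118672651803236738280783566890488318753189887920219469126191692322489942043558269,
   152026859910464931366013052669194455312262149939188499481358654253772530652404562257594975048929349625839748928864693575129030809,
   157883543843036719232158035734463767550273162916966686331430260787485551964011220953552593392172133113244059812894372845035026565,
   92420378661321535575752242540541615912419844302864113290583986590509596555325747568434595489328920239122195246786561331060292882,
   102746282601337961125264076154361993963355830230876078325666185188868158602662682761432067646289587486179056776009567122126729222,
   85035996013164458034491499042441813259761726518799419769726169237793811652613266321080639973561097653235312636616360883562976411,
   111859746051332552390215139418827271008050079913942279999450696558128905648021121119733832304369886063952029093336063231167567271,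
   116385569264412921232114623911956812677455412274233808658490145078816848965850706145098505432638366665528335564198757324780948802,
   44118432762523362437998927961622270973335169868507301376283394291953130273555449228836251408714466678829806320192890678335172700,
   113223960252812692748889750755613606838915409545659852689944314671372195973451843994113975882792506215552253863394277070085807302,
   126490254340053165760455547894510956408894433329302576779009570247656351104240221565151677138864423505142895158982557092839386328,
   115396796475142280673930939428464960904328064769791845857695828122010477711035812394570519229012310251627417411647133130349216881,
   81058828401180053068235445376980055402574723570876782647224463125018588297780382677884434109970527215373474045163580349732038755,
   160828000010185795068720568151567881341290343764338548610580177349968144902337960916178889033712553389282094598512512210935623829,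
   74182480660705172997711618101263607628256155627020892981639430459647528382615445719680971711922732085854901104873415421881100385,
   59844160077895832740739287882640916290566273172381280400520536991537656300895278101407780766002187512403984463189440534148195403,
   156115625991002656768014689474241130247772347801943875103293274482365605218520615888558366822459622716379985718312150837117496360,
   60001404007286671712074894776230341706389862789267734530950290742004076204538774012125778629507636445811482755772380139151892532,
   3794275180128377091639574036764685364535950857523710002444946112771297432041422848,
   173132756799536795303435594462245916639015520097320315534850592174791900724476260221779690565765607970767353696630903542251593062,
   132963995527958453543477122186464058261988461248437667156776853270481050894175768387861167417982600058844105839143319142230421858,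
   27432886080561827510192625059472390029866455063571407100355232244001049586838582511433012347732594581537013672889380676898698551,
   110438233648633834500247797055592141743971550930982826680876031376165193374681892119345045056419976611394979400342194893333040168,
   58410718755442993048642377899056577373787020596839871485406944721444074055286999468788497203934233376985771100919593197556236384,
   106741185724272634411235556009831890535317104500908583243883678900992236352834416808392565972906207596772850236984552429147171168,
   143252498323242566438754611929373081290555797037535314642039474893603907444983428481063097986541667003163274849301901409657366773,
   134544987273147878813453991110534718224160214161118817969749166102871841643462398871950712907753419626278446507445646401005955093,
   22469170843465078818659826601913318221755315274089041524908233324553679232028669765191760110201135801462518956081032952134289852,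
   16603162637357747022985358626682806829703823881927636706342556328497673927903328347923443977104076173219960755903554126512266714,
   83876189232832734113996375944827593460520186270903178328966207061537864314222258451659838865121601542533512801763319116147748203,
   111713942048129611635198878584522594544105596178016077223744968920387477716083177396603364874644374080277788595690774464940075237,
   94170772813006847087838996115348549707696477082015979344281756486524149110339461318475534510849638847388686012922349664390533365,
   128072804451129242796298919622315468858474929041724634624793279121139748450282221577487194261415854338193450442554605624244717811,
   14570038039124116429630942014851186019940308268315600340692398528388919669543169860917669519437673791914237538673590246231708809,
   105548782301758718449385414629450406645744146296929915391132945359933370879390499290074972465324087190523661303914066028856057923,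
   92845727238867785787511711363263006566604579080271059644070060171995899273214069279986585165838594257955861325232115347513128295,
   37455314401702991690193385564719660512191960966685818430706558527565236797856874944776557630745291758139812561630464594562943311,
   114354476774392686051301577525986907427310841363003667075066951811007244574533261662666567596205677701283249085986068365742412069,
   5513998872721587402589802104761137446957113501116553847834548814741726888935634059544512506450025150370192693460970534573896875,
   163482009744483209070219717402928733239393442431367948270349169965295541000200120192559131974025094749039758315846486379034074239,
   59674929749885529099407597563784526904370201573542424408383666899947408418338782396876532328129620399483001112911034554422305867,
   118385932931345411194531478216134476117185527406433073823555871098526688037859627879015279966497755537310740027899731007398574090,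
   161446381323327221469962934518217395912948603165367838855604682367458413519050230581292692615445486773390961252081939198483016744,
   21153791001287955166461289857048673274508949854856999017108761448780985319561963066406054734070889115122918784800747465736192,
   129870580319675038314991845947348248094082381666741055613424248998988271206306787200511712348315078961181310832450443696578698740,
   128191414538468525810891579216899244599924244733337552400218128308908190797681703633858423905473059818131350741252728894745913655,
   102523665242027660635105090642324278403361622675825396021527527466581985050443407305266030241960366395421539984655960088943784215,
   76083021579262832368979968308895929046701322503654503115604732436287931263828764553814601461227593783864723659753621131012506863,
   49726634725811314566236715910747307229893979996047524909329203423060983009261872736930285661247264296825791027713726365321806884,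
   110369326778298623066389676190431964529869420806686878068020292334770346175990174812634413401037439347132406061894809087355863239,
   48049925069543308465638029747075517826366505975582934784977136154327781288622148840046252649398728778126206065802567027786924266,
   32849736235571902476825618516304048634280447413692398000738691035257004304995914108914851161627131225237914659079942795985714280,
   159285017556753454579340433700860618725152270247943695180444863256672948362941496632285646728150976149027423077100049819884373465,
   81429235546217308109090759187142524531305150436051424112131869891789419824298145194299653768051414406873517001873334380022315255,
   2239744742177804210557442280568444278121645497234649534899989100963791871180160945380877493271607115776,
   44719460692584375805570477254981231314628156396203419524451693143272663912807558099027294964536709213166992916013642530984860768,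
   114603351952780103254325467263971739461523396786400753401210750773323246716115164054375635636474927329950618467368679378572658817,
   5231251532225064687333427095043714943209362400477708008689987285679579980730635877891702739755173821271145747324617035227375943,
   24352121035132228556298750124585842864704245945987038667391381346151399541056685459824954184800994778530883239395007095612157094,
   118852561480461062055587999870869844341625328106813947910435305638218642960878130384480050283828043327632395955727585470483660864,
   19244734331388429136524794354113656555012867027895757528540298481523220333988465855768255900420961159199403624707494144077263889,
   124811924547731209260128162588748387071993945654081102250907506418453240850321940894904836446902955428539147824098178325312509112,
   159130814547306569875012646687679420531863516837413086609982597612457393166824125114573927852947229174984929281490163821083875754,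
   130037823921872038967074246382371179882911016554702908861264707342649537105550108922733841107733754896308284342866161063895026944,
   96639009507052063027370127032208374418026785208792499738186550868376461818068096599864988559063151981447928287325736863925584960,
   102786415504996616467486452753883401723508639070632846087709661880179659859330315151425327098161848091770598967950847165646085281,
   41414983805242920856948902620921566731133734444010754831219821998260581048007180078332594050419566595590678974171298656101253125,
   36009795073738585433707735835294928751608610720856263936424830820046398381223781770526201489604505397413667469434223405342925950,
   74455051771480605854000090720908593122567701162192235784355724867536848017454374382628113927114079188174732584288090771088847984,
   79523171629409882648924572858905183621081119858419525791298950403578063806019801364701452059440146859587727486344646729180577264,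
   161788440188690188744227042242179691635512565665810016790957724007224448887655614615440830347811364328416209172463194656057085172,
   98566009691140796263660165945266115634351506494720398655082041175136938807141532747209447425038675349961090468756251641614779521,
   58540305929368233889124536659993451079541373811440951032709630596596940107811262923787932322461703542525181600898749098995292474,
   163269859227916438179424171802487146080740634315642872537555260509199650449989955528352826159906609142998649281796277678933969350,
   57193271191859797980719705098651990199417321385204681434405375713092944502297642657833783757137404235779334790768629380998860098,
   138268219304280801733220445485154411858956584577121223134890405196020959555229825386876911054741215956450816916772981737842221239,
   123272189727560581766021800385158964440095847276766709836474118740710815047340081300928730376443842613632682205607196973878053010,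
   171808714777339454470859408189534205840726721760416574685131418014457754847298261728729063464927691790617299996473431218805064992,
   144649217779774660873834621759826502316808910555767367091861671263476611556123144420739302608209095647053801401307116601346310320,
   42033195203249796749109730695739411985426630583228407947659680991075651745535311084601784844514477157238301651638451898255672788,
   116791457942460490223959591813953367277128330169035516962754956198252496689262423799424253687515180053318421712975042337582602377,
   78937845431593607097459741706820591032143351401453336105904431736408726127987630594771040243395458041398832909946972435277873522,
   34486279051659141999536604432918307504915495501214728614412090168750887811093673488527470542493995927843756842679355868620897761,
   169640058726274423464023251894634085434598578382951859918399148696376758941935399198096999540139814839914068680611772518414490980,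
   16355927180461777884068010190242213003840684706056361099945587926928981922564228255094320464742493869182865294692231396924391426,
   113943284220866702876647298634154426919557618246795285823109624638447069953717413635045898373767295338625407518502774265334668737,
   122073588956838525451840610494520677986829630144239602239284741761544246213726993607405845841493031852510485278664616027139237988,
   34419813429256574952826622401144178947684464413294839983174131939228506033169388770076875930492653203872010713059852687209820598,
   159344375414514071547048774727413120893507509479738425404050088855678866148564242440949808670613446016332687343358983802098801036,
   158723151811430849394604889208596015190443954832156531201954611522764450655624302962141376305380142845518268037117232303313393032,
   74818625046407986048311509262060321829759343422896632970936033582078886086982984544187121861748817208569914893317959408118183059,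
   129945930125625750034559032643444725418097681360445943669045628032845678482073563637043451457220169896293542983088235247100642730,
   6740417412075769642447515762037223310297048820946965156849159391522479305447801703963090091666215079566658492110196980668650906,
   39430958688481020852816639893903287855234905671317770261406884237698993376697875676412437851524630048389886042377535598821028344,
   75067253989017991915454580393640044316436732067766456718394470461743641358600816047741162670798810038306984973550648883079789635,
   36770459057028544441908306456103851076083506345274183905017860886005182129194185118623184072098794707189592942342161479501332601,
   137243650800849806521312374609820334933984365690086343904874793266763955492052754862319043900612477634643041907748016308792522048,
   111678306408693377388633279231703686835543263259365163570683659975993617838326780342758133965909305513938425081440651624794093869,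
   74636597990127491126933076070995259601400710461161285178663805243319030444148643599982350247722786842286571142551229417683077436,
   154327432962091197879856062869112073854822945986850721274664964026694250429869664025700571435664382770354403716350615113251734685,
   141427703649922060677642761052100760423950492095593066043222424082014091422766866183027872098019346928252119272813808503004481864,
   9847186708311191320083792418290045859086847531692277364786333919627202387882362936929248209192468114023993059723862840918987805,
   25503407226555539757246042241766754287264291142819233881876778613920094344313873351152253465651938704610396946340704319088924814,
   1827717653214388360195587802326581842982206582157063595495397176127433714131540526643240276208941091263219771914104380160647648,
   66810598079923523250355103535606271592739406577863394847932669644413730349680441260107979978827347818910846527187199485861562547,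
   126801198949707054041408187983492950576836152198502687801098740390305704521793835564325574134354317028126417151188786807563109785,
   32906695871448499543205428553857360614532419953644952660906579446256146192729063200402837982568437951557127594195868692722519381,
   93148088308586082864920526794548794780606803627397968270465985562000595481223912302730127202258704973471430621738687727253384601,
   155080783714159729822685284487406591777000705278164575898169575007558154221116146034888245680259853399303527421153209817381511428,
   147502424098343716013417628614324316901146398208363243919900611383536661333676796683458942241974657091563981192829001126670307734,
   85839035852241091391529346197445517876359323565640908622413810953479913024871765453032748936463077349100094281610213242772511076,
   101224500645428367478018901951459396803205121043083585700762135454638900713758228168968797821848302348904433089951868539742171257,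
   35135691916802883019796691385822779876054354865188753754107591259966586430105569425828351282955046173831443095993015006676696492,
   111451071128815348498910131158006522618645868150345221087561188343391243377591170827071819284926328445710938337625358048113599900,
   125246894857937563914664783279635210434151003474125665274648261835686776175998795330915774469766304277887248544610419228232844582,
   108403138662870180770164680661611021908637130203143252444294905878489973498376900526509028889397438080662293706363215076925042851,
   154291919297335992501581846056237322078003422468662425205622775867517742850309201244805951828067592606846476563709511169473536413,
   133891265415503491716117095207648343525379364448059504679893017372257843211259040955891681007012065275868724247514518825017174382,
   102393206876814514360467993449038097232773172782939373623133534257353157661502093192263789831764812934147985276069477324633055362,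
   16133458341900200513147491264884193772365534642609748016843555451522985353867196406175660505972055529446340286211571224686306692,
   150791409296714184941995401624950087583014000549355260357854543193210056961101972587853498586566118498139586076336941241556176172,
   166456477834356229511710172643495250712214956350205695735761893056449759221060703573932651180445466306203500701714294840001527100,
   61402868983765833270612351469675957706105327946018079571423403693632208364259306329557593759839033662079832867584783524731265290,
   41966182106030915593723998969518871143257426027692924968613670854359365086431294937780599712224145230612279195768659249637588197,
   65587454577624000981158658608934874131140371142708200278763442460173334490428110860475654590382675264462080284835076875554760783,
   149412757685865589040398123113732362796687201486382851129552860288227396977352917693629962889056421896698871660770980071424099493,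
   55363326235115262299547455799098111265741972027791530940062635196619265482636854772456919454216168480554086485204335099773088178,
   11692026524998382397261646683316479367108136418567190124827167809636093682202011184990169511123084997568613138999692739481911593,
   55932645573780855967882190123007940712253826154175374491868571867410460675523557308902070907111166310221304610254147625310092362,
   75813405271617635398196888498458586182640829485414700535089835096288767138702524965420381310504037588643545731720675303493848382,
   80221935148975728259507485672221890318904663605339064793215339288765729421928168313173346587801432011735781381967416907444545917,
   140761845128236868367624193665788473648156210864927332833112485276543936170270000918557357977394474579249279916345880998009216306,
   101221856421553206483623094290227265719045807424351728575884996859457803090593282923585497065006543487765042725103768446308954233,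
   169463411879685500203913186479383194499586957752165476557573081155379285963215689435375419317807884983740007738503567361683294569,
   137427263740215566576324983379678790123941763302980335485666335183457577159720171163513042463192114837400398348946550455660700927,
   3331839553733900584218876275040354445449463944900144877566549202105830702088591459359046527318124852940202745561245876970935371,
   85377843012356397793013133932785688745240132410924214792738633504754781508844622241784467133590605810539083110875511680073584736,
   67389772258518774367448387117633193567737100811957742150358884162234287526975800094887101662032365551171264411202328281451162088,
   96031069418949238285418174667173650812997827259150034204468924873765419181053058146008041165919774485185905243817933713543813297,
   19721444831203361475643163100096522790305169944449556943342578726096811661838999743059714464877991762018709541189755091353415807,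
   121545950928810470669531563020632988043067550810942377338116966758364112601035873673431279317909363402185530359381373968303947020,
   79176704965989525463578400778377519906484549487009273198935647258782470986538587500691631145078444299747567103795633372205040991,
   159461225917822443123256752415785462114749192496171257651246059095730116009087043755956070926985310897170285380212630191792508181,
   161362857908397423557412623406745246461713915857593860429395148213948514324848263362744115717603786274807772280811016950673380461,
   146779142087917758637616399730127946131431388290518349327605584588115848200731653302988210437003629109404178507492235820405236958,
   172423544795831202404557246854640057393161119801950512172369737926082042778842325065228707508780769238168161635755354943775741402,
   156011439952874559844837376587047149766237322346892659803973796573660426255383622726911212427219476787537132008576427170033245310,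
   113459142028049308323380830988388687142653470709981194149255279230493497945857684829071339686561778629402615385524213291130716221,
   170229875719322834057950825609852072239719550226526645705372957897772669088529698356051885110234355038367343628449385187795974537,
   84622005731741410467656545287084711924192129159052244122977032759876969702798924939018059855077651324978687819769419352786574671,
   129945930125625750034559032643444725418097681360445943672579322162402447141240158638529288488875137690044780899331447649685882282,
   90844583122071792185393643108211053810669692814616016443208361560027843268847346404500004516467894118146805493040228808122515889,
   158724473923368429891802793039212080732523611641522459764393180820354999467206775584833026683468715277141734251315330584959915400,
   67430423354893911919607877324114307087283460424457948721763835764215413779844845840672622395116142287391229271522195076507926799,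
   23689731566956327793245360232632375517804172952113161486006704391550683252457590750060398320671640115119423400230884433261093951,
   155027025903309948598332255745353937957423666200372532986197531676269263269146841226165515708544370554649667253287203307552605216,
   120794266434734541817055161408326803913090562562779275699451730891006337812572014841221669256452926179574361395748255772531813563,
   161874637008988979303293033057139335010885741365176796337282956075171984244707153201126321814751672200290068167507841003418713333,
   39963394654698862297205149602804034866905523804681929516448320473904475839621658521806146332498840642764310366086722565387346225,
   64942837185028322373629042098341561969373715419257785639182941560580585147916540302328635651040754876194464711264978452379711870,
   111324556954703877795979341755526034159732957250831472777791229292665611099196018722188234272795245993633895621757199945878125932,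
   114169953630350260474278208476170568468952387553865420774133624985754882848153926638722449835553367511004412351352727305768562824,
   46779287865802919588782472422765083605013545431629220740523487858487436938664004389533953934568673148999095348350245160256595027,
   12554203470773361527671578846415332832204710888928069025792,
   160839550264267663474142764427297902294267768811821703346358529062520648939576719515749153272843785132947055625587354523726631966,
   38225377130529466146321336090913488396180672874075271203565876114340511471695119719896268817669374896299495403057098007643667643,
   153397474976988199303550533344373709153293957276720619198174469946042384959795628746026068945220495910727910971277781829147802724,
   92072717859972736829784086899703944336051853891081400292491428055980519234945077416001876919923131151200840130584485218299057575,
   102975491013395416199523211029278220986170037307931248191980822294452252545359919080550864264112461544822862677582331325042469360,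
   81770945744529016864961025547087048822666888222130686501866682391315183594695159216969588956114379293399714609697500436420180425,
   116857442025566715320638978535752368067185352507225982937257836946117363808887953613247189157163175667864794954323759117575110035,
   110427941548649020598956093796432407571524742500955153108552152650874880,
   153066841390197322734970565572483188871399300125970963689960273400716097957090971297925880282640431739167738646510199512654452094,
   107915078784574087801410079365664244255128462649810597496845848489656823197999571394902561197152733852213909669144757504248633581,
   859466508386694295752780759732582107206993741332670396150674092552815341923548595533372940791099665427459089462807679553572285,
   139132877326531420087629497825303143999701692934825403047753076236821561699119182117560811382731678345228185450298429537852172607,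
   161683641316277451766325321951172879369868016076344732749160856444024873313631971018118218522667113344143268598623572895914272827,
   153415844605176390987189584563717461788621987204087346454802686212443745561998989205781591810875430351970449080874016084761837714,
   128348805299464945922047703918950246447427833268834232003565849701258740903032091264804075072250836072979199312786530160573722677,
   51167165628411732655984251655561665278396089484533370467261972917815646144978047611710462832938895604396141774131944082317387008,
   102269782945771091789094103239515676287615591350614235496043396554302939886117736928158662084889435913313816120087437142874592715,
   136292604475940055596696287876089019736265358094225689020942005727753302974292280662758593459787123565616502092915166533800455259,
   144973531137547040365917339617800078471332957301517261822758469818804107209968857601537266293772898136541918026480073730013179203,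
   167806161064678834580741132904083548894254655906813187250986133534891128828981815683171805273847530304742127316099029770259816535,
   140761845128236868367624193665788473648156210864927332833112485276543936562588859380224905717131313529728430922743096277011373362,
   78371251283155604006004418872159980501990086487164902231512154015722795086534685135587282965154799378938164139415621434110999791,
   87195465169017297479253905693963941282128240869895332886635552076738896971917168129585052688639666513152940207574171289084163198,
   1510785092019099745346940557632114136317771999627168906420426151581352471925464605884399121074430806332189798084857398710821206,
   101756577175932625204468602931215272388703336472433285315200375648915610327432221801521254583223278393268673983782282657770488077,
   69993549612343236634860612568490306229534917684836005518689468082026963044389986841626298979410196691108121962499666677053289877,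
   73419115430537424954377569928755357549290661551237006284402604263382941530104197143331889101166521430750089230107101120470982100,
   3146586746742185075946416984168346669185360619064467409166889604980000579474937782671590571950312673157679241053111288931313123,
   75710531773172264823025594627533413479712684415322504270644740713322857149440468300129183303571688667195560686056586728080435449,
   101289919805849104178398123182644680525863797102365807456685552109832980536736781874486683571366769203227084610509352803720304103,
   110622640028826761182356215211513093712964035807491026025045437141873354309056081335328926977643511638328790764911569371200093526,
   1711466981285303536385612016027025101366314646642536697775675033007384945563604975825152081077555230288405177486704546168388740,
   141817010671671692473816048024107568660310503752300233420290712671223468464294436819832687033962704545168799845870871404104533388,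
   15012715382310196919577003651108002767584920360993690261099505997377238100851314616691000405011556621976128579660887639037821239,
   56775544536274199187147382220244472803645797102990308804302554119869604722016706231569199372706378777864603176458638448522380563,
   62338845895231779843709573366272332339341694468870867454116996194114189098346639202982591753715531613990789300684026018991154212,
   5359850323924495687716296250545570623655093334474186092920093830409995067744757317902665520262849201496616292755556877864101329,
   73947317305358755006554729619361133204545558269978009910629310333087906898283099303816375554301419798826159051622606497528273269,
   121936312363523569874635764923503155887680123613874655918779638630101017433961840880714676317290821720362709213141713067142720923,
   139768040169097203322511607337860659592511681020315509019610880563656039548687007226809429891008090776051409895759986190988693740,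
   37731854278636806907868878917040289733763695355446287427204288403791411499284093892124799460966049305730107697251770949580385705,
   120767355332417109834253760930374968945801312840183127045021355464503874856375550965393806999183005466747104096518267072065750030,
   34986417996091854371405671459809273816763338028018531485745629673661219187613605576310907834656266195135129555061423446542327815,
   54550869306867260199399554176505605842898492657717571461492517787202584009036892780424303101052664372010787524192393373161936031,
   160529528234690983881729031747844400920726927089613551639004069224414465223582519091828256559804718615059711713092675976230433082,
   100695295398602483630951099072764081897690486934269016106663405163246636985591042310220581765032777673587998086037074310555890040,
   8081739896275589396164651343942002070548962594415425122015146426157181894346429601911624260922397086719484615347659751962116434,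
   58417992067313334172972071341495448840671852854676689398346747736009079071323370039838993646112937183356671406017197564549861525,
   69846544960796904877726808584880723950229708586112390576995244335281620474912423246982525105508960009977841331385521248520238351,
   167235062431412714645052560109631110389486159552244090832161801985991196201928239901946413470620132078347553781528912256147979599,
   168752373804208524034681010626820105810501824439651441550316961535875330424678918050074922285113785800563061529101065943829912855,
   144163752025773363622337234954118046208559074328088838711829987171320051069814120667783215242271746600410386199850905813842652636,
   69953464102839278197048076576083507731731697935168291202214953218368678181054089231965613309056999714074608875721031904474082686,
   56503676332739633421961238148284364184676831734740590769561502652028631485203534400366190364479813280976531693891295953567555779,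
   145958360577666214918845318208730295981538708892058617075354448941620982085121867279514590938157291095725794208396197816519065735,
   8872687930273008435059752042911687283010450424229610852405723824782091578157959791005498439480684629379593940019219441826970645,
   22366342959778308815147777492554118022616427307841922331973562500021438455615743228232712586782538538697985033537191340576825408,
   44041378724749726390487744574438349664351274740075186431747112844857324430498497995130493605200906860843768163847739358047466853,
   46995297313298297888135077356276064853556377513224942420356654035867235322791908347585938080660764492605132597155994193264731,
   111844233339106759209561995864022889962350311152658443220299211783285183219298729863585354796683268186542888066618679189366162492,
   33595886650061926088937392339080766009777566817007314260379868865759741657494913701658367659738517150201255051916185916694525031,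
   96907159763478051378626022933871309239692623883272607172641274746149474341563649616430149299640607960205650701010416473862249525,
   78544240320262331066826245640721607356246741642683101666715449307886820981835676918112628621503763928831691925469964038934127910,
   54628610341377702789075040291779674099983985007173337402315878360973739519121874499565402762365002512446508913961260911785217489,
   146430163570081044213469937574040134433675751296047746933815433995113328165699846747219386166982173685144210815375223337816346862,
   110622640028826761182356215211513093712964035807491026025045437141873354309056081335328926977643511637090850725626189096300969302,
   8725801989711420226836685900805050274788550944237172965287466613885913401790358113236873361195549508285406627817609596507493534,
   57537571515847930018875626306274308456621477973992463588075266502091399718428210674789997152850419074441548972827237441854610653,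
   62167261759826825068988790725017020966712302697120630936960606650942834063910967909236308765016405988625906046293762349725779280,
   124628774696895723466982076789947813787759155683503417957053757071027400256391537816800761937865095756180645449768645436011202724,
   106511854658160765665568211774023372095694272361839764483069370766047358892029254518629580004151097093417953017965234201285444732,
   126630196886440673158929606332920854264108859454893448039590522185334603648498056143423512472871538682438286925872482156623901897,
   10576895500643977583230644928524336637254474927428499508554380724390492659780981533203027367035444557561459392400373867085824,
   6060664827644599953439668060866618004864893554725706906610454742967741591102667863800529640894672931047837381805879023926083629,
   82788068872412333414172125820528760832948207882279585674461903405508803297558202610117434232152837755093293710552625343074024571,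
   56371217543004998525669676837678131455121119461956908831722202590840906671252350719128183352596808775661038539447888129165720949,
   24909751195732044706128811494707565113158465247536502900195028727019988744379131890277110215266187956734861865209792407915482383,
   65583809781377206381808657202506281142956911633856836364729336464014373864797837261592788221647715763226580094659327207257822561,
   70936867578275654442202219280041656891846695697034642183154650627796162669223198250615860844927688931299635675462714102439783684,
   29546048530061786073870939501428967479032800390168318185565778786914699326635866792237478022212801559845979343463775002023933293,
   76144626954109118033460022473671138073527534422059002954679193427678631241558730803053230820502687718175392144769314078415947068,
   115874002968173695865014132585648713910411999806956974516403152512336983960572959159182618313274025024733677719876249927021939952,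
   72847910029776459012257147228276342530163650316282039306596373797183731455789710532018986914471385337934835111130360657895017950,
   159966811163444304037551950131065895337990108527009067873990827161576890653860847504245852817599339138808359998042777074255964655,
   130742653324089206370995138337000587759054476136972970671813211662289375880955258626314396441298585601029552274687136566022235164,
   135068172882738685956274083302766364848216257979730563732574437176316721547808960599328568451308369663842772557367278240378900717,
   5600620192192130460487981812715814618988070228954236094062540847904609552901167677003799896121524953341471536909595383601557887,
   165377004899044980728452021034719850737000910470600644391900907809292977744631398139578782671610488892384765880084194825043583119,
   35650033588082026444621553810313890325924700696556592529651185517751570800733008702285261757929165048874841045993320702978540693,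
   53801065296780546598939409288812143620406846372958817116616209758370760686846121504826186550813232155064279138445391480536272196,
   144418074548071791806032173419655898039801788623788953224082661317757009777896216542833358219326545901011857147173889722167646344,
   171994553634280120051668373860088891789119245625100256703582334035133825748021013221348506802169683983994361361535080962977835082,
   111642030111967119207288829849871422572546838831534199519667363313732830124936869448049039703527827863809990364080091117198285213,
   150002325280411081005060727930820839052079313468401488247509857558805751936421720171430845885483106352985789835272185384461051303,
   24021587855281720433191759660219909155732429361607109781000834218569154079440589437105896664199336142353006314864903490982004077,
   30115486117375287230573663878829579412626842601946518543579307344335325302080142729528298108082874007892895164678851321390243942,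
   57509115438818469190294681060995288907311518194895325431832818834023150527372564058783272071582141615316084506289600070704761118,
   46167701682415103227387710428558646822789978118544536573638838208847162363009980696616166598290564086477626366940367983248574787,
   25984321859932042753897343247140058477690571723124112502373020788721435916963172731691474912674756127339416671608194674418186455,
   86654412301392831124810236746061331027476469558559129473959243915224115131069996443081825699907379157137493194527336696706769352,
   25309976000636181742617848938015091599112841918690827503383880301247572562598232037829991059223100488437076152865357405156924650,
   34665757344583843414046223710474443452690177930099378637128136836382448770199492458437598756318010832729795224188325447485351035,
   126416781267038700817030889888858233109029499551711454719947788118287749488191451684027439473024750948035134545712598426162888923,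
   39272218087260970745976068934954138193861665535877427856488541537281707942238726679977518088295835747714026825148097822332213673,
   124208631267316825993582548894668791892053488853446073434602896580453642209651703672964704514399590180948674035969487862554374613,
   124201152461305384028404600365274307363549671365750363842970022004538879463062623883844199752878805955664653522219929360993115522,
   84854665603007846117053620261033490521852449291101065209813122770248586143735711033688442568741784010547752840435241574381677812,
   135939567230652755158160803840191400613475558528732371070969710608020364462565438225267105919030721340300561726149751003254099116,
   81416270035150036728868866868488161612139793226485112178293977931961747848569890753798434669880445782594140718015164608395244958,
   72256163157641739103523429817978476580405368746289350440771319043147432148608384732778586255221279322542123249407517495366496618,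
   160329714870686823379156279780199189574567777780780221840872601795591582737124190743629227407534136390496091178235534878878011621,
   63148167347840841941342222972932841891777946112018452013631816043319259134981815612935073235797537019743846554771483046936923214,
   11272905116041608528357119017481778382513493095573291043117382450646588773270276788367783282743223530959481281906354398786023670,
   37493701403342202569407632654848525401814734997416354350652399037734143398765462682952758828859685627461885298136587338156004481,
   127581423667738070263283704822152956694209750050822137175045604972110510505868019710420958055812489709238369294160383073071449135,
   43976032343028698814104785031902520510576801377773442282404611365333770009002709763181865023234434610472662274388386288267349360,
   35398907115493594473012513739895334115092912522103279446482489754129489225390266449772610942725445744788567347854573696266300639,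
   45407206430613299859926288303011009995420946147357825528817533558688787914791524376082812015018695890588910657586810821159531707,
   21029834062759024930907961424307614075018779854543348216927170643834308797856214499883606586634958102276313011862549894408658242,
   61404752918582520399931087888913705874392648579071419618508691504430197313141075330954519170861549026411711498877555885069497527,
   101643697421936214600919678603318626323663839503378359126263174217819791108591157825543359197882163767342482347716355763775520230,
   139944877588083056480982036333596440814708533816684851964695344164129769152381858316158932633393843598241570640363993271444209838,
   87121223583777384443276058435003178042582484872014967757601726684970478978186428133821699243428297266468294631969207956424281221,
   14405402171169111920236934442469883646686756837847961518702155024832647579573231898490938105162301027939678369027407012341116024,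
   37998429354837444454546237409068297563844014716141116649393427084264416244429213281910162572825334000100883089436107295137365299]

/-- Apply `f` to the evaluated number `n`. -/
noncomputable def forceN {α : Type} (n : ℕ) (f : ℕ → α) : α :=
  Nat.rec (motive := fun _ => α) (f 0) (fun m _ => f (Nat.succ m)) n

theorem forceN_eq {α : Type} (n : ℕ) (f : ℕ → α) : forceN n f = f n := by
  cases n <;> rfl

/-- Sum of the five base-5 digits. -/
def dsum (k : ℕ) : ℕ := k % 5 + k / 5 % 5 + k / 25 % 5 + k / 125 % 5 + k / 625 % 5

/-- `k` is the code of an element of `I_6`. -/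
def validCode (k : ℕ) : Bool := Nat.ble 2 (dsum k) && Nat.ble (dsum k) 6

/-- The codes of the elements of `I_6`. -/
def codes : List ℕ := (List.range 3125).filter validCode

/-- Pack a list of numbers into one number, `w` bits for each. -/
noncomputable def pack (w : ℕ) (l : List ℕ) : ℕ :=
  List.rec (motive := fun _ => ℕ) 0 (fun x _ ih => Nat.add x (Nat.mul (Nat.pow 2 w) ih)) l

/-- Table of the positions of the codes, 12 bits for each. -/
noncomputable def posTable (l : List ℕ) : ℕ → ℕ → ℕ :=
  List.rec (motive := fun _ => ℕ → ℕ → ℕ) (fun _ acc => acc)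
    (fun k _ ih n acc =>
      forceN (Nat.add acc (Nat.mul n (Nat.pow 2 (Nat.mul 12 k)))) (ih (Nat.succ n))) l

/-- Entry number `k` of a packed table. -/
def look (w t k : ℕ) : ℕ := Nat.mod (Nat.shiftRight t (Nat.mul w k)) (Nat.pow 2 w)

/-- One term of a row of the product. -/
def termMask (bm : ℕ → ℕ) (a0 a1 a2 a3 a4 a5 : ℕ) (t : Tup) (acc : ℕ) : ℕ :=
  cond (Nat.ble a0 t.1 && (Nat.ble a1 t.2.1 && (Nat.ble a2 t.2.2.1 && (Nat.ble a3 t.2.2.2.1 &&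
      (Nat.ble a4 t.2.2.2.2.1 && Nat.ble a5 t.2.2.2.2.2)))))
    (Nat.xor (bm ((t.2.1 - a1) + 5 * (t.2.2.1 - a2) + 25 * (t.2.2.2.1 - a3) +
      125 * (t.2.2.2.2.1 - a4) + 625 * (t.2.2.2.2.2 - a5))) acc) acc

/-- A row of the product, from coordinates. -/
noncomputable def rowMaskC (bm : ℕ → ℕ) (L : List (Tup × Tup)) (a0 a1 a2 a3 a4 a5 : ℕ) : ℕ :=
  List.rec (motive := fun _ => ℕ) 0 (fun t _ ih => termMask bm a0 a1 a2 a3 a4 a5 t.1 ih) L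

/-- The row with code `k` of the product. -/
noncomputable def rowMask (bm : ℕ → ℕ) (k : ℕ) : ℕ :=
  forceN (6 - dsum k) fun a0 => forceN (k % 5) fun a1 => forceN (k / 5 % 5) fun a2 =>
    forceN (k / 25 % 5) fun a3 => forceN (k / 125 % 5) fun a4 => forceN (k / 625 % 5) fun a5 =>
      rowMaskC bm tdata a0 a1 a2 a3 a4 a5

/-- The complete check. -/
noncomputable def checkAll : Bool :=
  forceN (pack 426 invRows) fun B => forceN (posTable codes 0 0) fun P =>
    forceN (pack 12 codes) fun C => codes.all fun k =>
      Nat.beq (rowMask (fun m => look 426 B (look 12 P m)) k) (Nat.pow 2 (look 12 P k)) &&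
        Nat.beq (look 12 C (look 12 P k)) k

set_option maxRecDepth 100000 in
theorem checkAll_true : checkAll = true := by
  decide +kernel

end SexticAux

namespace SexticAux

/-- A tuple as a function. -/
def tf (t : Tup) : Fin (2 * 2 + 2) → ℕ :=
  ![t.1, t.2.1, t.2.2.1, t.2.2.2.1, t.2.2.2.2.1, t.2.2.2.2.2]

/-- The code of an exponent vector. -/
def code (x : Fin (2 * 2 + 2) → ℕ) : ℕ := x 1 + 5 * x 2 + 25 * x 3 + 125 * x 4 + 625 * x 5

/-- The underlying exponent vector. -/
def vv (i : IdxSet 2 6 6) : Fin (2 * 2 + 2) → ℕ := fun e => (i.1 e).1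

theorem vv_inj {i j : IdxSet 2 6 6} (h : vv i = vv j) : i = j := by
  apply Subtype.ext
  funext e
  apply Fin.ext
  exact congrFun h e

theorem vv_le (i : IdxSet 2 6 6) (e) : vv i e ≤ 4 := by
  have := (i.1 e).2
  change _ < 5 at this
  change (i.1 e).1 ≤ 4
  omega

theorem vv_sum (i : IdxSet 2 6 6) :
    vv i 0 + vv i 1 + vv i 2 + vv i 3 + vv i 4 + vv i 5 = 6 := by
  have h := i.2
  exact (Fin.sum_univ_six (fun e : Fin 6 => vv i e)).symm.trans h

theorem digits_aux (a b c d e : ℕ) (ha : a ≤ 4) (hb : b ≤ 4) (hc : c ≤ 4) (hd : d ≤ 4)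
    (he : e ≤ 4) (N : ℕ) (hN : N = a + 5 * b + 25 * c + 125 * d + 625 * e) :
    N % 5 = a ∧ N / 5 % 5 = b ∧ N / 25 % 5 = c ∧ N / 125 % 5 = d ∧ N / 625 % 5 = e := by
  have q1 : N / 5 = b + 5 * c + 25 * d + 125 * e := by omega
  have q2 : N / 25 = c + 5 * d + 25 * e := by omega
  have q3 : N / 125 = d + 5 * e := by omega
  have q4 : N / 625 = e := by omega
  rw [q1, q2, q3, q4]
  clear q1 q2 q3 q4
  omega

theorem code_digits (i : IdxSet 2 6 6) :
    code (vv i) % 5 = vv i 1 ∧ code (vv i) / 5 % 5 = vv i 2 ∧ code (vv i) / 25 % 5 = vv i 3 ∧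
    code (vv i) / 125 % 5 = vv i 4 ∧ code (vv i) / 625 % 5 = vv i 5 ∧
    6 - dsum (code (vv i)) = vv i 0 ∧ code (vv i) ∈ codes := by
  have h0 := vv_le i 0
  have h1 := vv_le i 1
  have h2 := vv_le i 2
  have h3 := vv_le i 3
  have h4 := vv_le i 4
  have h5 := vv_le i 5
  have hs := vv_sum i
  obtain ⟨a1, a2, a3, a4, a5⟩ := digits_aux _ _ _ _ _ h1 h2 h3 h4 h5 (code (vv i)) rfl
  have ad : dsum (code (vv i)) = vv i 1 + vv i 2 + vv i 3 + vv i 4 + vv i 5 := by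
    unfold dsum; rw [a1, a2, a3, a4, a5]
  refine ⟨a1, a2, a3, a4, a5, by omega, ?_⟩
  unfold codes
  rw [List.mem_filter, List.mem_range]
  refine ⟨by unfold code; omega, ?_⟩
  unfold validCode
  rw [ad, Bool.and_eq_true, Nat.ble_eq, Nat.ble_eq]
  omega

theorem code_inj {i j : IdxSet 2 6 6} (h : code (vv i) = code (vv j)) : i = j := by
  obtain ⟨a1, a2, a3, a4, a5, a0, -⟩ := code_digits i
  obtain ⟨b1, b2, b3, b4, b5, b0, -⟩ := code_digits j
  apply vv_inj
  rw [h] at a0 a1 a2 a3 a4 a5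
  funext e
  change Fin 6 at e
  fin_cases e
  · exact a0.symm.trans b0
  · exact a1.symm.trans b1
  · exact a2.symm.trans b2
  · exact a3.symm.trans b3
  · exact a4.symm.trans b4
  · exact a5.symm.trans b5

/-- Bit of a mask, in `ZMod 2`. -/
def zb (m l : ℕ) : ZMod 2 := if m.testBit l then 1 else 0

theorem zb_xor (m m' l : ℕ) : zb (Nat.xor m m') l = zb m l + zb m' l := by
  have : (Nat.xor m m').testBit l = (m.testBit l ^^ m'.testBit l) := Nat.testBit_xor m m' l
  unfold zb
  rw [this]
  cases m.testBit l <;> cases m'.testBit l <;> decide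

theorem sum_list {ι : Type} (s : Finset ι) (L : List (Tup × Tup)) (g : ι → Tup → ZMod 2) :
    ∑ j ∈ s, (L.map (fun t => g j t.1)).sum = (L.map (fun t => ∑ j ∈ s, g j t.1)).sum := by
  induction L with
  | nil => simp
  | cons t L ih => simp [Finset.sum_add_distrib, ih]

theorem tdata_ok : ∀ t ∈ tdata, ((t.1.1 ≤ 4 ∧ t.1.2.1 ≤ 4 ∧ t.1.2.2.1 ≤ 4 ∧ t.1.2.2.2.1 ≤ 4 ∧
    t.1.2.2.2.2.1 ≤ 4 ∧ t.1.2.2.2.2.2 ≤ 4) ∧ t.1.1 + t.1.2.1 + t.1.2.2.1 + t.1.2.2.2.1 +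
    t.1.2.2.2.2.1 + t.1.2.2.2.2.2 = 12) := by
  decide +kernel

theorem exists_idx (a b c d e f : ℕ) (ha : a < 5) (hb : b < 5) (hc : c < 5) (hd : d < 5)
    (he : e < 5) (hf : f < 5) (h : a + b + c + d + e + f = 6) :
    ∃ j : IdxSet 2 6 6, vv j 0 = a ∧ vv j 1 = b ∧ vv j 2 = c ∧ vv j 3 = d ∧ vv j 4 = e ∧
      vv j 5 = f :=
  ⟨⟨(![⟨a, ha⟩, ⟨b, hb⟩, ⟨c, hc⟩, ⟨d, hd⟩, ⟨e, he⟩, ⟨f, hf⟩] : Fin 6 → Fin 5),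
    (Fin.sum_univ_six (fun x : Fin 6 =>
      ((![⟨a, ha⟩, ⟨b, hb⟩, ⟨c, hc⟩, ⟨d, hd⟩, ⟨e, he⟩, ⟨f, hf⟩] : Fin 6 → Fin 5) x).1)).trans h⟩,
    rfl, rfl, rfl, rfl, rfl, rfl⟩

theorem term_eq (bm : ℕ → ℕ) (l : ℕ) (i : IdxSet 2 6 6) (t : Tup)
    (ht : (t.1 ≤ 4 ∧ t.2.1 ≤ 4 ∧ t.2.2.1 ≤ 4 ∧ t.2.2.2.1 ≤ 4 ∧
    t.2.2.2.2.1 ≤ 4 ∧ t.2.2.2.2.2 ≤ 4) ∧ t.1 + t.2.1 + t.2.2.1 + t.2.2.2.1 +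
    t.2.2.2.2.1 + t.2.2.2.2.2 = 12) (acc : ℕ) :
    zb (termMask bm (vv i 0) (vv i 1) (vv i 2) (vv i 3) (vv i 4) (vv i 5) t acc) l =
      (∑ j : IdxSet 2 6 6, if vv i + vv j = tf t then zb (bm (code (vv j))) l else 0) +
        zb acc l := by
  obtain ⟨t0, t1, t2, t3, t4, t5⟩ := t
  simp only at ht
  obtain ⟨⟨h0, h1, h2, h3, h4, h5⟩, hs⟩ := ht
  have hsi := vv_sum i
  have key : ∀ j : IdxSet 2 6 6, vv i + vv j = tf (t0, t1, t2, t3, t4, t5) ↔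
      (vv i 0 + vv j 0 = t0 ∧ vv i 1 + vv j 1 = t1 ∧ vv i 2 + vv j 2 = t2 ∧
        vv i 3 + vv j 3 = t3 ∧ vv i 4 + vv j 4 = t4 ∧ vv i 5 + vv j 5 = t5) := by
    intro j
    constructor
    · intro h
      exact ⟨congrFun h 0, congrFun h 1, congrFun h 2, congrFun h 3, congrFun h 4, congrFun h 5⟩
    · rintro ⟨e0, e1, e2, e3, e4, e5⟩
      funext e
      change Fin 6 at e
      fin_cases e
      · exact e0
      · exact e1
      · exact e2
      · exact e3
      · exact e4
      · exact e5
  unfold termMask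
  simp only
  by_cases hc : vv i 0 ≤ t0 ∧ vv i 1 ≤ t1 ∧ vv i 2 ≤ t2 ∧ vv i 3 ≤ t3 ∧ vv i 4 ≤ t4 ∧ vv i 5 ≤ t5
  · have hb : (Nat.ble (vv i 0) t0 && (Nat.ble (vv i 1) t1 && (Nat.ble (vv i 2) t2 &&
        (Nat.ble (vv i 3) t3 && (Nat.ble (vv i 4) t4 && Nat.ble (vv i 5) t5))))) = true := by
      simp only [Bool.and_eq_true, Nat.ble_eq]; exact hc
    rw [hb, cond_true, zb_xor]
    rw [add_left_inj]
    obtain ⟨c0, c1, c2, c3, c4, c5⟩ := hc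
    obtain ⟨j0, v0, v1, v2, v3, v4, v5⟩ : ∃ j0 : IdxSet 2 6 6, vv j0 0 = t0 - vv i 0 ∧
        vv j0 1 = t1 - vv i 1 ∧ vv j0 2 = t2 - vv i 2 ∧ vv j0 3 = t3 - vv i 3 ∧
        vv j0 4 = t4 - vv i 4 ∧ vv j0 5 = t5 - vv i 5 :=
      exists_idx _ _ _ _ _ _ (by omega) (by omega) (by omega) (by omega) (by omega) (by omega)
        (by omega)
    have hcode : t1 - vv i 1 + 5 * (t2 - vv i 2) + 25 * (t3 - vv i 3) + 125 * (t4 - vv i 4) +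
        625 * (t5 - vv i 5) = code (vv j0) := by
      unfold code
      rw [v1, v2, v3, v4, v5]
    rw [hcode]
    have w0 : vv i 0 + vv j0 0 = t0 := by rw [v0]; exact Nat.add_sub_cancel' c0
    have w1 : vv i 1 + vv j0 1 = t1 := by rw [v1]; exact Nat.add_sub_cancel' c1
    have w2 : vv i 2 + vv j0 2 = t2 := by rw [v2]; exact Nat.add_sub_cancel' c2
    have w3 : vv i 3 + vv j0 3 = t3 := by rw [v3]; exact Nat.add_sub_cancel' c3
    have w4 : vv i 4 + vv j0 4 = t4 := by rw [v4]; exact Nat.add_sub_cancel' c4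
    have w5 : vv i 5 + vv j0 5 = t5 := by rw [v5]; exact Nat.add_sub_cancel' c5
    clear hcode v0 v1 v2 v3 v4 v5
    rw [Finset.sum_eq_single j0]
    · rw [if_pos ((key j0).2 ⟨w0, w1, w2, w3, w4, w5⟩)]
    · intro j _ hj
      rw [if_neg]
      intro h
      apply hj
      obtain ⟨e0, e1, e2, e3, e4, e5⟩ := (key j).1 h
      have x1 : vv j 1 = vv j0 1 := by omega
      have x2 : vv j 2 = vv j0 2 := by omega
      have x3 : vv j 3 = vv j0 3 := by omega
      have x4 : vv j 4 = vv j0 4 := by omega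
      have x5 : vv j 5 = vv j0 5 := by omega
      apply code_inj
      unfold code
      rw [x1, x2, x3, x4, x5]
    · intro h
      exact absurd (Finset.mem_univ _) h
  · have hb : (Nat.ble (vv i 0) t0 && (Nat.ble (vv i 1) t1 && (Nat.ble (vv i 2) t2 &&
        (Nat.ble (vv i 3) t3 && (Nat.ble (vv i 4) t4 && Nat.ble (vv i 5) t5))))) = false := by
      rw [Bool.eq_false_iff]
      intro h
      simp only [Bool.and_eq_true, Nat.ble_eq] at h
      exact hc h
    rw [hb, cond_false, Finset.sum_eq_zero, zero_add]
    intro j _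
    rw [if_neg]
    intro h
    obtain ⟨e0, e1, e2, e3, e4, e5⟩ := (key j).1 h
    exact hc ⟨e0 ▸ Nat.le_add_right _ _, e1 ▸ Nat.le_add_right _ _, e2 ▸ Nat.le_add_right _ _,
      e3 ▸ Nat.le_add_right _ _, e4 ▸ Nat.le_add_right _ _, e5 ▸ Nat.le_add_right _ _⟩

theorem row_eq (bm : ℕ → ℕ) (l : ℕ) (i : IdxSet 2 6 6) (L : List (Tup × Tup))
    (hL : ∀ t ∈ L, t ∈ tdata) :
    zb (rowMaskC bm L (vv i 0) (vv i 1) (vv i 2) (vv i 3) (vv i 4) (vv i 5)) l =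
      (L.map (fun t => ∑ j : IdxSet 2 6 6,
        if vv i + vv j = tf t.1 then zb (bm (code (vv j))) l else 0)).sum := by
  induction L with
  | nil => simp [rowMaskC, zb]
  | cons t L ih =>
    rw [List.map_cons, List.sum_cons, ← ih (fun s hs => hL s (List.mem_cons_of_mem _ hs))]
    exact term_eq bm l i t.1 (tdata_ok t (hL t List.mem_cons_self)) _

/-- The integral Hankel matrix. -/
def hank : Matrix (IdxSet 2 6 6) (IdxSet 2 6 6) ℤ :=
  Matrix.of fun i j => (tdata.map (fun t => if vv i + vv j = tf t.1 then (1 : ℤ) else 0)).sum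

theorem hank_cast (i j : IdxSet 2 6 6) : ((hank i j : ℤ) : ZMod 2) =
    (tdata.map (fun t => if vv i + vv j = tf t.1 then (1 : ZMod 2) else 0)).sum := by
  unfold hank
  rw [Matrix.of_apply]
  generalize tdata = L
  induction L with
  | nil => simp
  | cons t L ih =>
    rw [List.map_cons, List.sum_cons, List.map_cons, List.sum_cons, Int.cast_add, ih]
    congr 1
    split_ifs <;> simp

theorem hank_det : hank.det ≠ 0 := by
  have hch := checkAll_true
  unfold checkAll at hch
  rw [forceN_eq, forceN_eq, forceN_eq, List.all_eq_true] at hch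
  generalize pack 426 invRows = B at hch
  generalize posTable codes 0 0 = P at hch
  generalize pack 12 codes = C at hch
  set bm : ℕ → ℕ := fun m => look 426 B (look 12 P m) with hbm
  set N : Matrix (IdxSet 2 6 6) (IdxSet 2 6 6) (ZMod 2) :=
    Matrix.of fun j l => zb (bm (code (vv j))) (look 12 P (code (vv l))) with hN
  have hprod : hank.map (Int.castRingHom (ZMod 2)) * N = 1 := by
    ext i l
    obtain ⟨a1, a2, a3, a4, a5, a0, am⟩ := code_digits i
    obtain ⟨-, -, -, -, -, -, lm⟩ := code_digits l
    have hi := hch _ am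
    have hl := hch _ lm
    rw [Bool.and_eq_true] at hi hl
    have hi1 := Nat.eq_of_beq_eq_true hi.1
    have hi2 := Nat.eq_of_beq_eq_true hi.2
    have hl2 := Nat.eq_of_beq_eq_true hl.2
    unfold rowMask at hi1
    simp only [forceN_eq] at hi1
    rw [a0, a1, a2, a3, a4, a5] at hi1
    have hr := row_eq bm (look 12 P (code (vv l))) i tdata (fun _ h => h)
    rw [hi1] at hr
    rw [Matrix.mul_apply]
    have : ∀ j, (hank.map (Int.castRingHom (ZMod 2))) i j * N j l =
        (tdata.map (fun t => if vv i + vv j = tf t.1 then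
          zb (bm (code (vv j))) (look 12 P (code (vv l))) else 0)).sum := by
      intro j
      rw [Matrix.map_apply, hN, Matrix.of_apply, eq_intCast, hank_cast, ← List.sum_map_mul_right]
      congr 1
      apply List.map_congr_left
      intro t _
      rw [ite_mul, one_mul, zero_mul]
    rw [Finset.sum_congr rfl (fun j _ => this j)]
    rw [sum_list Finset.univ tdata (fun j t => if vv i + vv j = tf t then
          zb (bm (code (vv j))) (look 12 P (code (vv l))) else 0), ← hr]
    have h2 : (Nat.pow 2 (look 12 P (code (vv i)))).testBit (look 12 P (code (vv l))) =
        decide (look 12 P (code (vv i)) = look 12 P (code (vv l))) := Nat.testBit_two_pow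
    unfold zb
    rw [h2, Matrix.one_apply]
    by_cases hil : i = l
    · subst hil; simp
    · rw [if_neg hil, if_neg]
      intro h
      apply hil
      apply code_inj
      rw [← hi2, ← hl2, of_decide_eq_true h]
  intro h0
  have h1 : (hank.map (Int.castRingHom (ZMod 2))).det = 0 := by
    have := RingHom.map_det (Int.castRingHom (ZMod 2)) hank
    rw [h0, map_zero] at this
    exact this.symm
  have h3 := congrArg Matrix.det hprod
  rw [Matrix.det_mul, h1, zero_mul, Matrix.det_one] at h3
  exact absurd h3 (by decide)

theorem codes_length : codes.length = 426 := by
  decide +kernel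

theorem codes_surj (k : ℕ) (hk : k ∈ codes) : ∃ i : IdxSet 2 6 6, code (vv i) = k := by
  unfold codes at hk
  rw [List.mem_filter, List.mem_range] at hk
  obtain ⟨hk1, hk2⟩ := hk
  unfold validCode at hk2
  rw [Bool.and_eq_true, Nat.ble_eq, Nat.ble_eq] at hk2
  obtain ⟨i, -, i1, i2, i3, i4, i5⟩ := exists_idx (6 - dsum k) (k % 5) (k / 5 % 5) (k / 25 % 5)
    (k / 125 % 5) (k / 625 % 5) (by omega) (by omega) (by omega) (by omega) (by omega) (by omega)
    (by have : dsum k = k % 5 + k / 5 % 5 + k / 25 % 5 + k / 125 % 5 + k / 625 % 5 := rfl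
        omega)
  refine ⟨i, ?_⟩
  unfold code
  rw [i1, i2, i3, i4, i5]
  omega

theorem card_idx : Fintype.card (IdxSet 2 6 6) = 426 := by
  have hn : codes.Nodup := List.Nodup.filter _ List.nodup_range
  rw [← codes_length, ← List.toFinset_card_of_nodup hn, ← Finset.card_univ]
  refine Finset.card_bij (fun i _ => code (vv i)) ?_ ?_ ?_
  · intro i _
    rw [List.mem_toFinset]
    exact (code_digits i).2.2.2.2.2.2
  · intro i _ j _ h
    exact code_inj h
  · intro k hk
    rw [List.mem_toFinset] at hk
    obtain ⟨i, hi⟩ := codes_surj k hk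
    exact ⟨i, Finset.mem_univ _, hi⟩

end SexticAux

namespace SexticAux

/-- The index set of the coefficients. -/
abbrev AB := (Fin 3 → Fin 6) × Equiv.Perm (Fin (2 * 2 + 2))

theorem zeta_prim : IsPrimitiveRoot (zeta2d 6) 12 := by
  have h := Complex.isPrimitiveRoot_exp 12 (by norm_num)
  have e : zeta2d 6 = Complex.exp (2 * Real.pi * Complex.I / ((12 : ℕ) : ℂ)) := by
    unfold zeta2d
    norm_num
  rw [e]
  exact h

theorem orth (u w : ℕ) (hu : u ≤ 4) (hw : w ≤ 4) :
    ∑ k : Fin 6, (1 / 6 : ℂ) * (zeta2d 6 ^ ((w + 1) * (1 + 2 * (k : ℕ))))⁻¹ *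
      zeta2d 6 ^ ((u + 1) * (1 + 2 * (k : ℕ))) = if u = w then 1 else 0 := by
  have hp := zeta_prim
  have hz : zeta2d 6 ≠ 0 := hp.ne_zero (by norm_num)
  split_ifs with h
  · subst h
    have : ∀ k : Fin 6, (1 / 6 : ℂ) * (zeta2d 6 ^ ((u + 1) * (1 + 2 * (k : ℕ))))⁻¹ *
      zeta2d 6 ^ ((u + 1) * (1 + 2 * (k : ℕ))) = 1 / 6 := by
      intro k
      rw [mul_assoc, inv_mul_cancel₀ (pow_ne_zero _ hz), mul_one]
    rw [Finset.sum_congr rfl (fun k _ => this k)]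
    simp
  · set q : ℂ := (zeta2d 6 ^ (2 * (w + 1)))⁻¹ * zeta2d 6 ^ (2 * (u + 1)) with hq
    have hq1 : q ≠ 1 := by
      intro h1
      rw [hq, inv_mul_eq_one₀ (pow_ne_zero _ hz)] at h1
      have := hp.pow_inj (by omega) (by omega) h1
      omega
    have hq6 : q ^ 6 = 1 := by
      have h12 : zeta2d 6 ^ 12 = 1 := hp.pow_eq_one
      rw [hq, mul_pow, inv_pow, ← pow_mul, ← pow_mul,
        show 2 * (w + 1) * 6 = 12 * (w + 1) by ring, show 2 * (u + 1) * 6 = 12 * (u + 1) by ring,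
        pow_mul, pow_mul, h12]
      simp
    have : ∀ k : Fin 6, (1 / 6 : ℂ) * (zeta2d 6 ^ ((w + 1) * (1 + 2 * (k : ℕ))))⁻¹ *
      zeta2d 6 ^ ((u + 1) * (1 + 2 * (k : ℕ))) =
        ((1 / 6 : ℂ) * (zeta2d 6 ^ (w + 1))⁻¹ * zeta2d 6 ^ (u + 1)) * q ^ (k : ℕ) := by
      intro k
      rw [hq, mul_pow, inv_pow, ← pow_mul, ← pow_mul,
        show (w + 1) * (1 + 2 * (k : ℕ)) = (w + 1) + 2 * (w + 1) * k by ring,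
        show (u + 1) * (1 + 2 * (k : ℕ)) = (u + 1) + 2 * (u + 1) * k by ring,
        pow_add, pow_add, mul_inv]
      ring
    rw [Finset.sum_congr rfl (fun k _ => this k), ← Finset.mul_sum,
      Fin.sum_univ_eq_sum_range (fun k => q ^ k) 6, geom_sum_eq hq1, hq6]
    simp

theorem delta (s : Fin (2 * 2 + 2) → ℕ) (b : Equiv.Perm (Fin (2 * 2 + 2)))
    (hs : ∀ e : Fin (2 + 1), s (b (evIdx 2 e)) + s (b (odIdx 2 e)) = 4) :
    ∃ c : AB → ℂ, ∀ x : Fin (2 * 2 + 2) → ℕ,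
      ∑ ab : AB, c ab * pvec 2 6 (fun e => ((ab.1 e : ℕ))) ab.2 x = if x = s then 1 else 0 := by
  classical
  refine ⟨fun ab => if ab.2 = b then ∏ e : Fin (2 + 1),
    ((1 / 6 : ℂ) * (zeta2d 6 ^ ((s (b (evIdx 2 e)) + 1) * (1 + 2 * (ab.1 e : ℕ))))⁻¹) else 0, ?_⟩
  intro x
  rw [Fintype.sum_prod_type]
  have h1 : ∀ a : Fin 3 → Fin 6, (∑ b' : Equiv.Perm (Fin (2 * 2 + 2)),
      (if b' = b then ∏ e : Fin (2 + 1),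
        ((1 / 6 : ℂ) * (zeta2d 6 ^ ((s (b (evIdx 2 e)) + 1) * (1 + 2 * (a e : ℕ))))⁻¹) else 0) *
        pvec 2 6 (fun e => (a e : ℕ)) b' x) = (∏ e : Fin (2 + 1),
        ((1 / 6 : ℂ) * (zeta2d 6 ^ ((s (b (evIdx 2 e)) + 1) * (1 + 2 * (a e : ℕ))))⁻¹)) *
        pvec 2 6 (fun e => (a e : ℕ)) b x := by
    intro a
    rw [Finset.sum_eq_single b]
    · rw [if_pos rfl]
    · intro b' _ hb
      rw [if_neg hb, zero_mul]
    · intro h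
      exact absurd (Finset.mem_univ _) h
  rw [Finset.sum_congr rfl (fun a _ => h1 a)]
  by_cases hx : ∀ e : Fin (2 + 1), x (b (evIdx 2 e)) + x (b (odIdx 2 e)) = 6 - 2
  · have h2 : ∀ a : Fin 3 → Fin 6, (∏ e : Fin (2 + 1),
        ((1 / 6 : ℂ) * (zeta2d 6 ^ ((s (b (evIdx 2 e)) + 1) * (1 + 2 * (a e : ℕ))))⁻¹)) *
        pvec 2 6 (fun e => (a e : ℕ)) b x = ∏ e : Fin (2 + 1),
        ((1 / 6 : ℂ) * (zeta2d 6 ^ ((s (b (evIdx 2 e)) + 1) * (1 + 2 * (a e : ℕ))))⁻¹ *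
          zeta2d 6 ^ ((x (b (evIdx 2 e)) + 1) * (1 + 2 * (a e : ℕ)))) := by
      intro a
      unfold pvec
      rw [if_pos hx, Finset.prod_mul_distrib (f := fun e : Fin (2 + 1) =>
        ((1 / 6 : ℂ) * (zeta2d 6 ^ ((s (b (evIdx 2 e)) + 1) * (1 + 2 * (a e : ℕ))))⁻¹)),
        Finset.prod_pow_eq_pow_sum]
    rw [Finset.sum_congr rfl (fun a _ => h2 a)]
    have h3 := Finset.prod_univ_sum (fun _ : Fin (2 + 1) => (Finset.univ : Finset (Fin 6)))
      (fun e k => ((1 / 6 : ℂ) * (zeta2d 6 ^ ((s (b (evIdx 2 e)) + 1) * (1 + 2 * (k : ℕ))))⁻¹ *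
          zeta2d 6 ^ ((x (b (evIdx 2 e)) + 1) * (1 + 2 * (k : ℕ)))))
    rw [Fintype.piFinset_univ] at h3
    refine h3.symm.trans ?_
    have h4 : ∀ e : Fin (2 + 1), (∑ k : Fin 6,
        ((1 / 6 : ℂ) * (zeta2d 6 ^ ((s (b (evIdx 2 e)) + 1) * (1 + 2 * (k : ℕ))))⁻¹ *
          zeta2d 6 ^ ((x (b (evIdx 2 e)) + 1) * (1 + 2 * (k : ℕ))))) =
          if x (b (evIdx 2 e)) = s (b (evIdx 2 e)) then 1 else 0 := by
      intro e
      have := hx e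
      have := hs e
      exact orth _ _ (by omega) (by omega)
    rw [Finset.prod_congr rfl (fun e _ => h4 e)]
    by_cases hxs : x = s
    · subst hxs
      simp
    · rw [if_neg hxs]
      have : ∃ e : Fin (2 + 1), x (b (evIdx 2 e)) ≠ s (b (evIdx 2 e)) := by
        by_contra hne
        push Not at hne
        apply hxs
        funext y
        obtain ⟨z, rfl⟩ := b.surjective y
        have hzlt := z.2
        have hz : z = evIdx 2 ⟨z.1 / 2, by omega⟩ ∨ z = odIdx 2 ⟨z.1 / 2, by omega⟩ := by
          rcases Nat.mod_two_eq_zero_or_one z.1 with h | h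
          · left
            apply Fin.ext
            change z.1 = 2 * (z.1 / 2)
            omega
          · right
            apply Fin.ext
            change z.1 = 2 * (z.1 / 2) + 1
            omega
        rcases hz with h | h
        · rw [h]
          exact hne _
        · rw [h]
          have p1 := hne ⟨z.1 / 2, by omega⟩
          have p2 := hx ⟨z.1 / 2, by omega⟩
          have p3 := hs ⟨z.1 / 2, by omega⟩
          omega
      obtain ⟨e, he⟩ := this
      exact Finset.prod_eq_zero (Finset.mem_univ e) (if_neg he)
  · rw [if_neg]
    · apply Finset.sum_eq_zero
      intro a _
      unfold pvec
      rw [if_neg hx, mul_zero]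
    · intro h
      apply hx
      rw [h]
      exact hs

/-- The function behind a permutation. -/
def bf (t : Tup) : Fin (2 * 2 + 2) → Fin (2 * 2 + 2) :=
  ![Fin.ofNat 6 t.1, Fin.ofNat 6 t.2.1, Fin.ofNat 6 t.2.2.1, Fin.ofNat 6 t.2.2.2.1,
    Fin.ofNat 6 t.2.2.2.2.1, Fin.ofNat 6 t.2.2.2.2.2]

theorem bf_ok : ∀ t ∈ tdata, (∀ x y, bf t.2 x = bf t.2 y → x = y) ∧
    ∀ e : Fin (2 + 1), tf t.1 (bf t.2 (evIdx 2 e)) + tf t.1 (bf t.2 (odIdx 2 e)) = 4 := by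
  decide +kernel

theorem exists_coeff (L : List (Tup × Tup)) (hL : ∀ t ∈ L, t ∈ tdata) :
    ∃ c : AB → ℂ, ∀ x : Fin (2 * 2 + 2) → ℕ,
      ∑ ab : AB, c ab * pvec 2 6 (fun e => ((ab.1 e : ℕ))) ab.2 x =
        (L.map (fun t => if x = tf t.1 then (1 : ℂ) else 0)).sum := by
  induction L with
  | nil => exact ⟨fun _ => 0, fun x => by simp⟩
  | cons t L ih =>
    obtain ⟨c, hc⟩ := ih (fun s hs => hL s (List.mem_cons_of_mem _ hs))
    obtain ⟨hb, hsum⟩ := bf_ok t (hL t List.mem_cons_self)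
    have hbij : Function.Bijective (bf t.2) :=
      Finite.injective_iff_bijective.1 (fun x y h => hb x y h)
    obtain ⟨c', hc'⟩ := delta (tf t.1) (Equiv.ofBijective _ hbij) hsum
    refine ⟨fun ab => c' ab + c ab, fun x => ?_⟩
    rw [List.map_cons, List.sum_cons, ← hc x, ← hc' x, ← Finset.sum_add_distrib]
    exact Finset.sum_congr rfl (fun ab _ => add_mul _ _ _)

/-- The period matrix of a combination, as a square matrix. -/
noncomputable def pm (c : AB → ℂ) : Matrix (IdxSet 2 6 6) (IdxSet 2 6 6) ℂ :=
  Matrix.of fun i j => ∑ ab : AB, c ab * pvec 2 6 (fun e => ((ab.1 e : ℕ))) ab.2 (vv i + vv j)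

theorem exists_det_ne : ∃ c : AB → ℂ, (pm c).det ≠ 0 := by
  obtain ⟨c, hc⟩ := exists_coeff tdata (fun _ h => h)
  refine ⟨c, ?_⟩
  have : pm c = hank.map (Int.castRingHom ℂ) := by
    ext i j
    unfold pm hank
    rw [Matrix.of_apply, hc, Matrix.map_apply, Matrix.of_apply, map_list_sum, List.map_map]
    congr 1
    apply List.map_congr_left
    intro t _
    simp only [Function.comp]
    split_ifs <;> simp
  rw [this]
  have h2 := RingHom.map_det (Int.castRingHom ℂ) hank
  intro h0
  have h3 : Int.castRingHom ℂ hank.det = 0 := h2.trans h0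
  rw [eq_intCast, Int.cast_eq_zero] at h3
  exact hank_det h3

/-- The determinant as a polynomial in the coefficients. -/
noncomputable def QQ : MvPolynomial AB ℂ :=
  Matrix.det (Matrix.of fun i j : IdxSet 2 6 6 => ∑ ab : AB, MvPolynomial.X ab *
    MvPolynomial.C (pvec 2 6 (fun e => ((ab.1 e : ℕ))) ab.2 (vv i + vv j)))

theorem eval_QQ (c : AB → ℂ) : MvPolynomial.eval c QQ = (pm c).det := by
  unfold QQ
  rw [RingHom.map_det]
  refine congrArg Matrix.det (Matrix.ext fun i j => ?_)
  rw [RingHom.mapMatrix_apply, Matrix.map_apply, Matrix.of_apply, map_sum]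
  unfold pm
  rw [Matrix.of_apply]
  apply Finset.sum_congr rfl
  intro ab _
  rw [map_mul, MvPolynomial.eval_X, MvPolynomial.eval_C]

theorem QQ_ne : QQ ≠ 0 := by
  obtain ⟨c, hc⟩ := exists_det_ne
  intro h
  apply hc
  rw [← eval_QQ, h, map_zero]

theorem exists_int : ∃ c : AB → ℤ, (pm (fun ab => (c ab : ℂ))).det ≠ 0 := by
  by_contra hne
  push Not at hne
  apply QQ_ne
  apply MvPolynomial.funext_set (fun _ : AB => Set.range (fun n : ℤ => (n : ℂ)))
  · intro _
    exact Set.infinite_range_of_injective Int.cast_injective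
  · intro x hx
    have : ∀ ab, ∃ n : ℤ, (n : ℂ) = x ab := fun ab => hx ab (Set.mem_univ _)
    choose c hc using this
    rw [eval_QQ, map_zero, ← hne c]
    congr 2
    funext ab
    exact (hc ab).symm

end SexticAux

/-- For the sextic Fermat fourfold (`n = 4`, i.e. `h = 2`, `d = 6`): both index sets
`I_{(n/2)d−n−2} = I_6` and `I_d = I_6` have 426 elements; there is a `ℤ`-linear
combination of the period vectors `p^{a,b}` of the linear cycles whose (square, 426×426)
period matrix is invertible; and consequently the set of complex coefficient tuples for
which the period matrix is singular is the zero locus of a nonzero polynomial. -/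
theorem general_hodge_cycle_sextic_fourfold :
    Fintype.card (IdxSet 2 6 (2 * 6 - (2 * 2 + 2))) = 426 ∧
    Fintype.card (IdxSet 2 6 6) = 426 ∧
    (∃ c : (Fin 3 → Fin 6) × Equiv.Perm (Fin (2 * 2 + 2)) → ℤ,
      IsUnit (pmat 2 6 (fun i =>
        ∑ ab : (Fin 3 → Fin 6) × Equiv.Perm (Fin (2 * 2 + 2)),
          (c ab : ℂ) * pvec 2 6 (fun e => ((ab.1 e : ℕ))) ab.2 i))) ∧
    (∃ Q : MvPolynomial ((Fin 3 → Fin 6) × Equiv.Perm (Fin (2 * 2 + 2))) ℂ, Q ≠ 0 ∧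
      ∀ c : (Fin 3 → Fin 6) × Equiv.Perm (Fin (2 * 2 + 2)) → ℂ,
        (pmat 2 6 (fun i =>
            ∑ ab : (Fin 3 → Fin 6) × Equiv.Perm (Fin (2 * 2 + 2)),
              c ab * pvec 2 6 (fun e => ((ab.1 e : ℕ))) ab.2 i)).det = 0
          ↔ MvPolynomial.eval c Q = 0) := by
  refine ⟨SexticAux.card_idx, SexticAux.card_idx, ?_, ?_⟩
  · obtain ⟨c, hc⟩ := SexticAux.exists_int
    refine ⟨c, ?_⟩
    exact (Matrix.isUnit_iff_isUnit_det (SexticAux.pm (fun ab => (c ab : ℂ)))).2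
      (isUnit_iff_ne_zero.2 hc)
  · refine ⟨SexticAux.QQ, SexticAux.QQ_ne, fun c => ?_⟩
    rw [SexticAux.eval_QQ]
    exact Iff.rfl
end

section
/- For each pair (n,d) in the list (2,4), (2,5), (2,7), (4,3), (4,4), (4,5), (4,6), there exists a ℤ-linear combination p = Σ_{(a,b)} c_{a,b}·p^{a,b} of the period vectors of the linear cycles such that the rank of the period matrix [p_{i+j}] equals min{#I_d, #I_{(n/2)d−n−2}}, the maximal possible value for any period matrix. -/
open Finset Matrix

/-! ### Delta functions in the span of the period vectors -/

lemma zeta_sq_prim (d : ℕ) (hd : d ≠ 0) : IsPrimitiveRoot (zeta2d d ^ 2) d := by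
  have h := Complex.isPrimitiveRoot_exp d hd
  have e : zeta2d d ^ 2 = Complex.exp (2 * Real.pi * Complex.I / d) := by
    have hd' : (d : ℂ) ≠ 0 := by exact_mod_cast hd
    rw [zeta2d, ← Complex.exp_nat_mul]
    congr 1
    field_simp
    norm_num
  rw [e]; exact h

lemma zeta_ne (d : ℕ) : zeta2d d ≠ 0 := Complex.exp_ne_zero _

lemma orth (d x y : ℕ) (hd : 2 ≤ d) (hx : x ≤ d - 2) (hy : y ≤ d - 2) :
    ∑ a : Fin d, (d : ℂ)⁻¹ * (zeta2d d ^ ((x + 1) * (1 + 2 * (a : ℕ))))⁻¹ *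
      zeta2d d ^ ((y + 1) * (1 + 2 * (a : ℕ))) = if x = y then 1 else 0 := by
  have hz := zeta_ne d
  have hd' : (d : ℂ) ≠ 0 := by
    have : d ≠ 0 := by omega
    exact_mod_cast this
  split_ifs with hxy
  · subst hxy
    have : ∀ a : Fin d, (d : ℂ)⁻¹ * (zeta2d d ^ ((x + 1) * (1 + 2 * (a : ℕ))))⁻¹ *
      zeta2d d ^ ((x + 1) * (1 + 2 * (a : ℕ))) = (d : ℂ)⁻¹ := by
      intro a
      rw [mul_assoc, inv_mul_cancel₀ (pow_ne_zero _ hz), mul_one]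
    simp [this, hd']
  · have hp := zeta_sq_prim d (by omega)
    set ω := zeta2d d ^ 2 with hω
    have hω0 : ω ≠ 0 := pow_ne_zero _ hz
    set q := ω ^ (y + 1) / ω ^ (x + 1) with hq
    have hq1 : q ≠ 1 := by
      intro h
      rw [hq, div_eq_one_iff_eq (pow_ne_zero _ hω0)] at h
      have := hp.pow_inj (by omega) (by omega) h
      omega
    have hqd : q ^ d = 1 := by
      rw [hq, div_pow, pow_right_comm, hp.pow_eq_one, pow_right_comm, hp.pow_eq_one]
      simp
    have key : ∀ a : Fin d, (d : ℂ)⁻¹ * (zeta2d d ^ ((x + 1) * (1 + 2 * (a : ℕ))))⁻¹ *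
      zeta2d d ^ ((y + 1) * (1 + 2 * (a : ℕ))) =
        ((d : ℂ)⁻¹ * (zeta2d d ^ (x + 1))⁻¹ * zeta2d d ^ (y + 1)) * q ^ (a : ℕ) := by
      intro a
      rw [hq, hω, div_pow, ← pow_mul, ← pow_mul, ← pow_mul, ← pow_mul]
      field_simp
      ring
    rw [Finset.sum_congr rfl (fun a _ => key a), ← Finset.mul_sum,
      Fin.sum_univ_eq_sum_range (fun a => q ^ a), geom_sum_eq hq1, hqd]
    simp

lemma evod_surj (h : ℕ) (k : Fin (2 * h + 2)) : ∃ e, k = evIdx h e ∨ k = odIdx h e := by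
  refine ⟨⟨k.1 / 2, by have := k.2; omega⟩, ?_⟩
  rcases Nat.even_or_odd' k.1 with ⟨c, hc | hc⟩
  · left; ext; simp [evIdx]; omega
  · right; ext; simp [odIdx]; omega

/-- `s` is compatible with some linear cycle. -/
def Matched (h d : ℕ) (s : Fin (2 * h + 2) → ℕ) : Prop :=
  ∃ b : Equiv.Perm (Fin (2 * h + 2)),
    ∀ e : Fin (h + 1), s (b (evIdx h e)) + s (b (odIdx h e)) = d - 2

lemma Matched.le {h d : ℕ} {s : Fin (2 * h + 2) → ℕ} (hs : Matched h d s) (k) : s k ≤ d - 2 := by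
  obtain ⟨b, hb⟩ := hs
  obtain ⟨e, he⟩ := evod_surj h (b.symm k)
  have := hb e
  rcases he with he | he <;> rw [← he, Equiv.apply_symm_apply] at this <;> omega

noncomputable def genVec (h d : ℕ) (ab : (Fin (h + 1) → Fin d) × Equiv.Perm (Fin (2 * h + 2))) :
    (Fin (2 * h + 2) → ℕ) → ℂ := pvec h d (fun e => ((ab.1 e : ℕ))) ab.2

lemma delta_mem (h d : ℕ) (hd : 2 ≤ d) (s : Fin (2 * h + 2) → ℕ) (hs : Matched h d s) :
    (Pi.single s 1 : (Fin (2 * h + 2) → ℕ) → ℂ) ∈ Submodule.span ℂ (Set.range (genVec h d)) := by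
  obtain ⟨b, hb⟩ := hs
  have : (Pi.single s 1 : (Fin (2 * h + 2) → ℕ) → ℂ) = ∑ a : Fin (h + 1) → Fin d,
      (∏ e, ((d : ℂ)⁻¹ * (zeta2d d ^ ((s (b (evIdx h e)) + 1) * (1 + 2 * (a e : ℕ))))⁻¹)) •
        genVec h d (a, b) := by
    funext t
    rw [Finset.sum_apply]
    by_cases ht : ∀ e : Fin (h + 1), t (b (evIdx h e)) + t (b (odIdx h e)) = d - 2
    · have e1 : ∀ a : Fin (h + 1) → Fin d,
        ((∏ e, ((d : ℂ)⁻¹ * (zeta2d d ^ ((s (b (evIdx h e)) + 1) * (1 + 2 * (a e : ℕ))))⁻¹)) •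
        genVec h d (a, b)) t = ∏ e, ((d : ℂ)⁻¹ *
          (zeta2d d ^ ((s (b (evIdx h e)) + 1) * (1 + 2 * (a e : ℕ))))⁻¹ *
          zeta2d d ^ ((t (b (evIdx h e)) + 1) * (1 + 2 * (a e : ℕ)))) := by
        intro a
        rw [Pi.smul_apply, smul_eq_mul, genVec, pvec, if_pos ht, ← Finset.prod_pow_eq_pow_sum,
          ← Finset.prod_mul_distrib]
      rw [Finset.sum_congr rfl (fun a _ => e1 a)]
      have e2 := Finset.prod_univ_sum (fun _ : Fin (h + 1) => (Finset.univ : Finset (Fin d)))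
        (fun e (a : Fin d) => (d : ℂ)⁻¹ *
          (zeta2d d ^ ((s (b (evIdx h e)) + 1) * (1 + 2 * (a : ℕ))))⁻¹ *
          zeta2d d ^ ((t (b (evIdx h e)) + 1) * (1 + 2 * (a : ℕ))))
      rw [Fintype.piFinset_univ] at e2
      rw [← e2]
      have e3 : ∀ e : Fin (h + 1), _ := fun e => orth d (s (b (evIdx h e))) (t (b (evIdx h e))) hd
        (by have := hb e; omega) (by have := ht e; omega)
      rw [Finset.prod_congr rfl (fun e _ => e3 e)]
      by_cases hst : s = t
      · subst hst; simp
      · rw [Pi.single_eq_of_ne (Ne.symm hst)]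
        symm
        rw [Finset.prod_eq_zero_iff]
        by_contra hcon
        apply hst
        have h1 : ∀ e, s (b (evIdx h e)) = t (b (evIdx h e)) := by
          intro e
          by_contra hne
          exact hcon ⟨e, Finset.mem_univ _, if_neg hne⟩
        funext k
        obtain ⟨e, he⟩ := evod_surj h (b.symm k)
        have h2 := h1 e
        have h3 := hb e
        have h4 := ht e
        rcases he with he | he
        · rw [← he, Equiv.apply_symm_apply] at h2
          exact h2
        · rw [← he, Equiv.apply_symm_apply] at h3 h4
          omega
    · have hst : t ≠ s := by rintro rfl; exact ht hb
      rw [Pi.single_eq_of_ne hst]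
      symm
      apply Finset.sum_eq_zero
      intro a _
      rw [Pi.smul_apply, genVec, pvec, if_neg ht, smul_zero]
  rw [this]
  exact Submodule.sum_mem _ fun a _ => Submodule.smul_mem _ _ (Submodule.subset_span ⟨_, rfl⟩)

lemma exists_coef (h d : ℕ) (hd : 2 ≤ d) (p : (Fin (2 * h + 2) → ℕ) → ℂ)
    (hp : ∀ s, p s ≠ 0 → Matched h d s) :
    ∃ c : (Fin (h + 1) → Fin d) × Equiv.Perm (Fin (2 * h + 2)) → ℂ,
      ∑ ab, c ab • genVec h d ab = p := by
  rw [← Submodule.mem_span_range_iff_exists_fun]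
  have : p = ∑ s ∈ Fintype.piFinset (fun _ : Fin (2 * h + 2) => Finset.range (d - 1)),
      p s • (Pi.single s 1 : (Fin (2 * h + 2) → ℕ) → ℂ) := by
    funext t
    rw [Finset.sum_apply]
    simp only [Pi.smul_apply, smul_eq_mul, Pi.single_apply, mul_ite, mul_one, mul_zero]
    rw [Finset.sum_ite_eq]
    split_ifs with hm
    · rfl
    · by_contra hne
      apply hm
      rw [Fintype.mem_piFinset]
      intro k
      have := (hp t hne).le k
      rw [Finset.mem_range]; omega
  rw [this]
  refine Submodule.sum_mem _ fun s _ => ?_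
  by_cases h0 : p s = 0
  · rw [h0, zero_smul]; exact Submodule.zero_mem _
  · exact Submodule.smul_mem _ _ (delta_mem h d hd s (hp s h0))

/-! ### From complex to integral coefficients -/

lemma exists_int {ι κ : Type*} [Fintype ι] [Fintype κ] [DecidableEq κ]
    (M : ι → Matrix κ κ ℂ) (c : ι → ℂ) (hc : (∑ x, c x • M x).det ≠ 0) :
    ∃ z : ι → ℤ, (∑ x, (z x : ℂ) • M x).det ≠ 0 := by
  classical
  let P : Matrix κ κ (MvPolynomial ι ℂ) :=
    ∑ x, (MvPolynomial.X x : MvPolynomial ι ℂ) • (M x).map MvPolynomial.C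
  have hP : ∀ v : ι → ℂ, MvPolynomial.eval v P.det = (∑ x, v x • M x).det := by
    intro v
    rw [RingHom.map_det]
    congr 1
    ext i j
    simp [P, Matrix.sum_apply]
  by_contra hcon
  push Not at hcon
  apply hc
  rw [← hP]
  have : P.det = 0 := by
    apply MvPolynomial.funext_set (fun _ => Set.range ((↑) : ℤ → ℂ))
      (fun _ => Set.infinite_range_of_injective Int.cast_injective)
    intro x hx
    choose z hz using fun i => hx i (Set.mem_univ i)
    have : x = fun i => (z i : ℂ) := by funext i; exact (hz i).symm
    rw [this, hP, hcon, map_zero]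
  rw [this, map_zero]

/-! ### Main reduction -/

lemma reduction (h d N : ℕ) (hd : 2 ≤ d) (p : (Fin (2 * h + 2) → ℕ) → ℂ)
    (hp : ∀ s, p s ≠ 0 → Matched h d s)
    (r : Fin N → IdxSet h d (h * d - (2 * h + 2))) (k : Fin N → IdxSet h d d)
    (hdet : ((pmat h d p).submatrix r k).det ≠ 0)
    (hcard : Fintype.card (IdxSet h d (h * d - (2 * h + 2))) ≤ N) :
    ∃ c : (Fin (h + 1) → Fin d) × Equiv.Perm (Fin (2 * h + 2)) → ℤ,
      (pmat h d (fun i =>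
          ∑ ab : (Fin (h + 1) → Fin d) × Equiv.Perm (Fin (2 * h + 2)),
            (c ab : ℂ) * pvec h d (fun e => ((ab.1 e : ℕ))) ab.2 i)).rank
        = min (Fintype.card (IdxSet h d d))
            (Fintype.card (IdxSet h d (h * d - (2 * h + 2)))) := by
  obtain ⟨c, hc⟩ := exists_coef h d hd p hp
  have e1 : (∑ x, c x • (pmat h d (genVec h d x)).submatrix r k) =
      (pmat h d p).submatrix r k := by
    ext i j
    rw [← hc]
    simp [pmat, Matrix.sum_apply]
  obtain ⟨z, hz⟩ := exists_int (fun x => (pmat h d (genVec h d x)).submatrix r k) c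
    (by rw [e1]; exact hdet)
  refine ⟨z, ?_⟩
  set A := pmat h d (fun i =>
          ∑ ab : (Fin (h + 1) → Fin d) × Equiv.Perm (Fin (2 * h + 2)),
            (z ab : ℂ) * pvec h d (fun e => ((ab.1 e : ℕ))) ab.2 i) with hA
  have e2 : (∑ x, (z x : ℂ) • (pmat h d (genVec h d x)).submatrix r k) = A.submatrix r k := by
    ext i j
    simp [hA, pmat, Matrix.sum_apply, genVec]
  rw [e2] at hz
  have h1 : (A.submatrix r k).rank = N := by
    rw [Matrix.rank_of_isUnit _ ((Matrix.isUnit_iff_isUnit_det _).2 (isUnit_iff_ne_zero.2 hz)),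
      Fintype.card_fin]
  have h2 := Matrix.rank_submatrix_le A r k
  have h3 := A.rank_le_card_width
  have h4 := A.rank_le_card_height
  apply le_antisymm (le_min h3 h4)
  exact (min_le_right _ _).trans (hcard.trans (h1 ▸ h2))

/-- A weighted matrix whose diagonal dominates tropically has non-zero determinant. -/
lemma tropical_det {N : ℕ} (A : Matrix (Fin N) (Fin N) ℂ) (W : Fin N → Fin N → ℕ) (u : Fin N → ℕ)
    (hdiag : ∀ b, A b b = ((N : ℂ) + 1) ^ W b b)
    (hoff : ∀ a b, a ≠ b → A a b = 0 ∨
      (A a b = ((N : ℂ) + 1) ^ W a b ∧ W a b + u b + 1 ≤ W b b + u a)) : A.det ≠ 0 := by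
  have hB : (0 : ℝ) < (N : ℝ) + 1 := by positivity
  have hn : ‖(N : ℂ) + 1‖ = (N : ℝ) + 1 := by
    have : ((N : ℂ) + 1) = ((N + 1 : ℕ) : ℂ) := by push_cast; rfl
    rw [this, Complex.norm_natCast]; push_cast; rfl
  have key : (Matrix.of fun a b => (((N : ℂ) + 1) ^ u a)⁻¹ * A a b).det ≠ 0 := by
    apply det_ne_zero_of_sum_col_lt_diag
    intro b
    simp only [Matrix.of_apply, norm_mul, norm_inv, norm_pow, hn, hdiag]
    set D := (((N : ℝ) + 1) ^ u b)⁻¹ * ((N : ℝ) + 1) ^ W b b with hD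
    have hD0 : 0 < D := by positivity
    have hle : ∀ a ∈ Finset.univ.erase b, (((N : ℝ) + 1) ^ u a)⁻¹ * ‖A a b‖ ≤ D / ((N : ℝ) + 1) := by
      intro a ha
      rcases hoff a b (Finset.ne_of_mem_erase ha) with h0 | ⟨h0, h1⟩
      · rw [h0, norm_zero, mul_zero]; positivity
      · rw [h0, norm_pow, hn, hD, inv_mul_eq_div, inv_mul_eq_div, div_div,
          div_le_div_iff₀ (by positivity) (by positivity), ← pow_succ, ← pow_add, ← pow_add]
        exact pow_le_pow_right₀ (by linarith) (by omega)
    refine (Finset.sum_le_sum hle).trans_lt ?_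
    rw [Finset.sum_const, nsmul_eq_mul, ← mul_div_assoc, div_lt_iff₀ hB, mul_comm]
    have hc : ((Finset.univ.erase b).card : ℝ) ≤ N := by
      have := Finset.card_le_univ (Finset.univ.erase b)
      rw [Fintype.card_fin] at this
      exact_mod_cast this
    nlinarith
  rw [Matrix.det_mul_column] at key
  exact right_ne_zero_of_mul key

/-! ### Counting the rows -/

/-- Number of `i : Fin k → Fin m` with `t + ∑ i = N`. -/
def cnt (m N : ℕ) : ℕ → ℕ → ℕ
  | 0, t => if t = N then 1 else 0
  | k + 1, t => ((List.range m).map fun x => cnt m N k (t + x)).sum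

lemma lsum (f : ℕ → ℕ) (n : ℕ) : ((List.range n).map f).sum = ∑ k : Fin n, f k := by
  rw [Fin.sum_univ_eq_sum_range]; rfl

lemma card_le_cnt (m N k t : ℕ) :
    Fintype.card {i : Fin k → Fin m // t + ∑ e, (i e).1 = N} ≤ cnt m N k t := by
  induction k generalizing t with
  | zero =>
    rw [cnt]
    split_ifs with ht
    · exact Fintype.card_le_one_iff_subsingleton.2 inferInstance
    · rw [Nat.le_zero, Fintype.card_eq_zero_iff]
      constructor
      rintro ⟨i, hi⟩
      simp at hi
      exact ht hi
  | succ k ih =>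
    rw [cnt, lsum]
    refine le_trans ?_ (Finset.sum_le_sum fun x _ => ih (t + (x : Fin m).1))
    rw [← Fintype.card_sigma]
    refine Fintype.card_le_of_injective
      (fun i => ⟨i.1 0, ⟨fun e => i.1 e.succ, by
        have := i.2; rw [Fin.sum_univ_succ, ← add_assoc] at this; exact this⟩⟩) ?_
    rintro ⟨i, hi⟩ ⟨j, hj⟩ hij
    simp only [Sigma.mk.injEq] at hij
    obtain ⟨h0, h1⟩ := hij
    apply Subtype.ext
    funext e
    refine Fin.cases h0 (fun e => ?_) e
    have hsub : ∀ (x y : Fin m), x = y → ∀ (p : {i : Fin k → Fin m // t + x.1 + ∑ e, (i e).1 = N})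
        (q : {i : Fin k → Fin m // t + y.1 + ∑ e, (i e).1 = N}), p ≍ q → p.1 = q.1 := by
      rintro x _ rfl p q hpq
      rw [eq_of_heq hpq]
    exact congrFun (hsub _ _ h0 _ _ h1) e

/-! ### Encoding tuples in base 16 and the certificate checker -/

def dig (c k : ℕ) : ℕ := c / 16 ^ k % 16

def enc {n : ℕ} (s : Fin n → ℕ) : ℕ := ∑ k : Fin n, s k * 16 ^ (k : ℕ)

lemma enc_add {n : ℕ} (s t : Fin n → ℕ) : enc (fun k => s k + t k) = enc s + enc t := by
  simp [enc, add_mul, Finset.sum_add_distrib]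

/-- `c` encodes an element of `I_N`. -/
def vld (n m N c : ℕ) : Bool :=
  ((List.range n).all fun k => Nat.ble (dig c k + 1) m) &&
  (Nat.beq ((List.range n).map (dig c)).sum N &&
   Nat.beq ((List.range n).map (fun k => dig c k * 16 ^ k)).sum c)

lemma vld_spec {h d N c : ℕ} (hv : vld (2 * h + 2) (d - 1) N c = true) :
    ∃ i : IdxSet h d N, enc (fun k => (i.1 k).1) = c := by
  rw [vld, Bool.and_eq_true, Bool.and_eq_true, List.all_eq_true, Nat.beq_eq, Nat.beq_eq,
    lsum, lsum] at hv
  obtain ⟨h1, h2, h3⟩ := hv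
  refine ⟨⟨fun k => ⟨dig c k, ?_⟩, h2⟩, h3⟩
  have := h1 k (List.mem_range.2 k.2)
  exact Nat.le_of_ble_eq_true this

/-- Boolean or, through the recursor (fast in the kernel). -/
noncomputable def bor (a b : Bool) : Bool := @Bool.rec (fun _ => Bool) b true a

/-- Boolean and, through the recursor (fast in the kernel). -/
noncomputable def band (a b : Bool) : Bool := @Bool.rec (fun _ => Bool) false b a

lemma bor_eq (a b : Bool) : bor a b = (a || b) := by cases a <;> rfl

lemma band_eq (a b : Bool) : band a b = (a && b) := by cases a <;> rfl

noncomputable def T4 (m x y z w : ℕ) : Bool :=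
  bor (band (Nat.beq (Nat.add x y) m) (Nat.beq (Nat.add z w) m))
  (bor (band (Nat.beq (Nat.add x z) m) (Nat.beq (Nat.add y w) m))
   (band (Nat.beq (Nat.add x w) m) (Nat.beq (Nat.add y z) m)))

noncomputable def T6 (m x y z w u v : ℕ) : Bool :=
  bor (band (Nat.beq (Nat.add x y) m) (T4 m z w u v))
  (bor (band (Nat.beq (Nat.add x z) m) (T4 m y w u v))
  (bor (band (Nat.beq (Nat.add x w) m) (T4 m y z u v))
  (bor (band (Nat.beq (Nat.add x u) m) (T4 m y z w v))
   (band (Nat.beq (Nat.add x v) m) (T4 m y z w u)))))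

/-- Test for the support, on codes, for four variables. -/
noncomputable def suppT1 (m c : ℕ) : Bool :=
  T4 m (Nat.mod c (nat_lit 16)) (Nat.mod (Nat.div c (nat_lit 16)) (nat_lit 16))
    (Nat.mod (Nat.div c (nat_lit 256)) (nat_lit 16))
    (Nat.mod (Nat.div c (nat_lit 4096)) (nat_lit 16))

/-- Test for the support, on codes, for six variables; the first condition quickly discards
codes with a digit larger than `m`. -/
noncomputable def suppT2 (m c : ℕ) : Bool :=
  band (Nat.beq (Nat.land (Nat.add c (Nat.mul (Nat.sub (nat_lit 7) m) (nat_lit 1118481)))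
    (nat_lit 8947848)) (nat_lit 0)) <|
  T6 m (Nat.mod c (nat_lit 16)) (Nat.mod (Nat.div c (nat_lit 16)) (nat_lit 16))
    (Nat.mod (Nat.div c (nat_lit 256)) (nat_lit 16))
    (Nat.mod (Nat.div c (nat_lit 4096)) (nat_lit 16))
    (Nat.mod (Nat.div c (nat_lit 65536)) (nat_lit 16))
    (Nat.mod (Nat.div c (nat_lit 1048576)) (nat_lit 16))

noncomputable def permOf {n : ℕ} (f : Fin n → Fin n) (hf : Function.Injective f) :
    Equiv.Perm (Fin n) :=
  Equiv.ofBijective f (Finite.injective_iff_bijective.1 hf)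

lemma matched1 {d : ℕ} (s : Fin 4 → ℕ) (f : Fin 4 → Fin 4) (hf : Function.Injective f)
    (h0 : s (f 0) + s (f 1) = d - 2) (h1 : s (f 2) + s (f 3) = d - 2) : Matched 1 d s := by
  refine ⟨permOf f hf, fun e => ?_⟩
  fin_cases e
  · exact h0
  · exact h1

lemma matched2 {d : ℕ} (s : Fin 6 → ℕ) (f : Fin 6 → Fin 6) (hf : Function.Injective f)
    (h0 : s (f 0) + s (f 1) = d - 2) (h1 : s (f 2) + s (f 3) = d - 2)
    (h2 : s (f 4) + s (f 5) = d - 2) : Matched 2 d s := by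
  refine ⟨permOf f hf, fun e => ?_⟩
  fin_cases e
  · exact h0
  · exact h1
  · exact h2

lemma supp1 (d : ℕ) (s : Fin 4 → ℕ) (hs : ∀ k, s k < 16)
    (ht : suppT1 (d - 2) (enc s) = true) : Matched 1 d s := by
  have a0 := hs 0
  have a1 := hs 1
  have a2 := hs 2
  have a3 := hs 3
  have e : enc s = s 0 + s 1 * 16 + s 2 * 256 + s 3 * 4096 := by
    simp [enc, Fin.sum_univ_succ]; ring
  have e0 : enc s % 16 = s 0 := by omega
  have e1 : enc s / 16 % 16 = s 1 := by omega
  have e2 : enc s / 256 % 16 = s 2 := by omega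
  have e3 : enc s / 4096 % 16 = s 3 := by omega
  change T4 (d - 2) (enc s % 16) (enc s / 16 % 16) (enc s / 256 % 16) (enc s / 4096 % 16) = true
    at ht
  rw [e0, e1, e2, e3] at ht
  simp only [T4, bor_eq, band_eq, Nat.add_eq, Bool.or_eq_true, Bool.and_eq_true, Nat.beq_eq] at ht
  rcases ht with ⟨p, q⟩ | ⟨p, q⟩ | ⟨p, q⟩
  · exact matched1 s ![0, 1, 2, 3] (by decide) p q
  · exact matched1 s ![0, 2, 1, 3] (by decide) p q
  · exact matched1 s ![0, 3, 1, 2] (by decide) p q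

lemma supp2 (d : ℕ) (s : Fin 6 → ℕ) (hs : ∀ k, s k < 16)
    (ht : suppT2 (d - 2) (enc s) = true) : Matched 2 d s := by
  have a0 := hs 0
  have a1 := hs 1
  have a2 := hs 2
  have a3 := hs 3
  have a4 := hs 4
  have a5 := hs 5
  have e : enc s = s 0 + s 1 * 16 + s 2 * 256 + s 3 * 4096 + s 4 * 65536 + s 5 * 1048576 := by
    simp [enc, Fin.sum_univ_succ]; ring
  have e0 : enc s % 16 = s 0 := by omega
  have e1 : enc s / 16 % 16 = s 1 := by omega
  have e2 : enc s / 256 % 16 = s 2 := by omega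
  have e3 : enc s / 4096 % 16 = s 3 := by omega
  have e4 : enc s / 65536 % 16 = s 4 := by omega
  have e5 : enc s / 1048576 % 16 = s 5 := by omega
  have ht := (Bool.and_eq_true _ _ ▸ (band_eq _ _).symm.trans ht).2
  change T6 (d - 2) (enc s % 16) (enc s / 16 % 16) (enc s / 256 % 16) (enc s / 4096 % 16)
    (enc s / 65536 % 16) (enc s / 1048576 % 16) = true at ht
  rw [e0, e1, e2, e3, e4, e5] at ht
  simp only [T6, T4, bor_eq, band_eq, Nat.add_eq, Bool.or_eq_true, Bool.and_eq_true, Nat.beq_eq] at ht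
  rcases ht with ⟨o, h⟩ | ⟨o, h⟩ | ⟨o, h⟩ | ⟨o, h⟩ | ⟨o, h⟩ <;>
    rcases h with ⟨p, q⟩ | ⟨p, q⟩ | ⟨p, q⟩
  · exact matched2 s ![0, 1, 2, 3, 4, 5] (by decide) o p q
  · exact matched2 s ![0, 1, 2, 4, 3, 5] (by decide) o p q
  · exact matched2 s ![0, 1, 2, 5, 3, 4] (by decide) o p q
  · exact matched2 s ![0, 2, 1, 3, 4, 5] (by decide) o p q
  · exact matched2 s ![0, 2, 1, 4, 3, 5] (by decide) o p q
  · exact matched2 s ![0, 2, 1, 5, 3, 4] (by decide) o p q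
  · exact matched2 s ![0, 3, 1, 2, 4, 5] (by decide) o p q
  · exact matched2 s ![0, 3, 1, 4, 2, 5] (by decide) o p q
  · exact matched2 s ![0, 3, 1, 5, 2, 4] (by decide) o p q
  · exact matched2 s ![0, 4, 1, 2, 3, 5] (by decide) o p q
  · exact matched2 s ![0, 4, 1, 3, 2, 5] (by decide) o p q
  · exact matched2 s ![0, 4, 1, 5, 2, 3] (by decide) o p q
  · exact matched2 s ![0, 5, 1, 2, 3, 4] (by decide) o p q
  · exact matched2 s ![0, 5, 1, 3, 2, 4] (by decide) o p q
  · exact matched2 s ![0, 5, 1, 4, 2, 3] (by decide) o p q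

/-- The weight (exponent) given to a code: a pseudo-random hash. -/
def wt (A P K c : ℕ) : ℕ := Nat.mul K (Nat.mod (Nat.mul (Nat.mul c c) A) P)

/-- Certificate entry: row code, column code, potential. -/
abbrev Ent := ℕ × ℕ × ℕ

/-- Dominance test at a fixed code `c`; the last argument is the diagonal bound. -/
noncomputable def okAt (T : ℕ → Bool) (A P K uy w c : ℕ) : Bool :=
  bor (Nat.ble (Nat.succ (Nat.add (wt A P K c) uy)) w) (not (T c))

/-- Column `cy`, with potential `uy` and diagonal weight `wy`, is dominated by its diagonal. -/
noncomputable def okPair (T : ℕ → Bool) (A P K cy sy uy wy cx ux : ℕ) : Bool :=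
  bor (Nat.beq cx cy) (okAt T A P K uy (Nat.add wy ux) (Nat.add cx sy))

/-- `List.all`, directly through the recursor (fast in the kernel). -/
noncomputable def allR (f : ℕ → ℕ → Bool) (l : List Ent) : Bool :=
  @List.rec Ent (fun _ => Bool) true (fun x _ ih => band (f x.1 x.2.2) ih) l

lemma allR_spec (f : ℕ → ℕ → Bool) (l : List Ent) (hl : allR f l = true) (x : Ent) (hx : x ∈ l) :
    f x.1 x.2.2 = true := by
  induction l with
  | nil => simp at hx
  | cons y l ih =>
    change band (f y.1 y.2.2) (allR f l) = true at hl
    rw [band_eq, Bool.and_eq_true] at hl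
    rcases List.mem_cons.1 hx with rfl | hx
    · exact hl.1
    · exact ih hl.2 hx

noncomputable def okCol (T : ℕ → Bool) (A P K : ℕ) (L : List Ent) (y : Ent) : Bool :=
  allR (okPair T A P K y.1 y.2.1 y.2.2 (wt A P K (Nat.add y.1 y.2.1))) L

lemma all_chunk {α : Type*} (f : α → Bool) (l : List α) (i n : ℕ)
    (h1 : ((l.drop i).take n).all f = true) (h2 : (l.drop (i + n)).all f = true) :
    (l.drop i).all f = true := by
  rw [← List.take_append_drop n (l.drop i), List.all_append, h1, List.drop_drop, h2]
  rfl

noncomputable def okEnt (T : ℕ → Bool) (h d : ℕ) (y : Ent) : Bool :=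
  vld (2 * h + 2) (d - 1) (h * d - (2 * h + 2)) y.1 &&
    (vld (2 * h + 2) (d - 1) d y.2.1 && T (y.1 + y.2.1))

/-- The codes are strictly increasing. -/
def incr : List Ent → Bool
  | [] => true
  | [_] => true
  | x :: y :: l => Nat.ble (x.1 + 1) y.1 && incr (y :: l)

lemma incr_spec (L : List Ent) (hL : incr L = true) : L.Pairwise (fun x y => x.1 < y.1) := by
  have : L.IsChain (fun x y => x.1 < y.1) := by
    induction L with
    | nil => simp
    | cons x l ih =>
      cases l with
      | nil => simp
      | cons y l =>
        rw [incr, Bool.and_eq_true] at hL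
        rw [List.isChain_cons_cons]
        exact ⟨Nat.le_of_ble_eq_true hL.1, ih hL.2⟩
  have tr : IsTrans Ent (fun x y => x.1 < y.1) := ⟨fun _ _ _ => lt_trans⟩
  exact List.isChain_iff_pairwise.1 this

theorem certificate (T : ℕ → Bool) (h d A P K : ℕ) (L : List Ent) (hd : 2 ≤ d) (hd9 : d ≤ 9)
    (hsupp : ∀ s : Fin (2 * h + 2) → ℕ, (∀ k, s k < 16) → T (enc s) = true →
      Matched h d s)
    (hcnt : cnt (d - 1) (h * d - (2 * h + 2)) (2 * h + 2) 0 ≤ L.length)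
    (hinc : incr L = true) (hent : L.all (okEnt T h d) = true)
    (hcol : L.all (okCol T A P K L) = true) :
    ∃ c : (Fin (h + 1) → Fin d) × Equiv.Perm (Fin (2 * h + 2)) → ℤ,
      (pmat h d (fun i =>
          ∑ ab : (Fin (h + 1) → Fin d) × Equiv.Perm (Fin (2 * h + 2)),
            (c ab : ℂ) * pvec h d (fun e => ((ab.1 e : ℕ))) ab.2 i)).rank
        = min (Fintype.card (IdxSet h d d))
            (Fintype.card (IdxSet h d (h * d - (2 * h + 2)))) := by
  classical
  set N := L.length with hN
  rw [List.all_eq_true] at hent hcol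
  have hent' : ∀ a : Fin N, okEnt T h d (L.get a) = true := fun a => hent _ (List.get_mem L a)
  have hr : ∀ a : Fin N, ∃ i : IdxSet h d (h * d - (2 * h + 2)),
      enc (fun k => (i.1 k).1) = (L.get a).1 := by
    intro a
    have := hent' a
    rw [okEnt, Bool.and_eq_true] at this
    exact vld_spec this.1
  have hk : ∀ a : Fin N, ∃ i : IdxSet h d d, enc (fun k => (i.1 k).1) = (L.get a).2.1 := by
    intro a
    have := hent' a
    rw [okEnt, Bool.and_eq_true, Bool.and_eq_true] at this
    exact vld_spec this.2.1
  choose r hr using hr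
  choose k hk using hk
  have hsum : ∀ a b : Fin N, enc (fun e => ((r a).1 e).1 + ((k b).1 e).1) =
      (L.get a).1 + (L.get b).2.1 := by
    intro a b
    rw [enc_add, hr, hk]
  let p : (Fin (2 * h + 2) → ℕ) → ℂ := fun s =>
    if (∀ k, s k < 16) ∧ T (enc s) = true then
      ((N : ℂ) + 1) ^ wt A P K (enc s) else 0
  have hlt : ∀ a b : Fin N, ∀ e, ((r a).1 e).1 + ((k b).1 e).1 < 16 := by
    intro a b e
    have h1 := ((r a).1 e).2
    have h2 := ((k b).1 e).2
    omega
  have hM : ∀ a b : Fin N, (pmat h d p).submatrix r k a b =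
      if T ((L.get a).1 + (L.get b).2.1) = true then
        ((N : ℂ) + 1) ^ wt A P K ((L.get a).1 + (L.get b).2.1) else 0 := by
    intro a b
    simp only [Matrix.submatrix_apply, pmat, Matrix.of_apply, p, hsum]
    by_cases hT : T ((L.get a).1 + (L.get b).2.1) = true
    · rw [if_pos ⟨hlt a b, hT⟩, if_pos hT]
    · rw [if_neg (fun hh => hT hh.2), if_neg hT]
  refine reduction h d N hd p ?_ r k ?_ ?_
  · intro s hs
    by_cases hc : (∀ k, s k < 16) ∧ T (enc s) = true
    · exact hsupp s hc.1 hc.2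
    · exact absurd (if_neg hc) hs
  · apply tropical_det _ (fun a b => wt A P K ((L.get a).1 + (L.get b).2.1))
      (fun a => (L.get a).2.2)
    · intro b
      have := hent' b
      rw [okEnt, Bool.and_eq_true, Bool.and_eq_true] at this
      rw [hM, if_pos this.2.2]
    · intro a b hab
      rw [hM]
      by_cases hT : T ((L.get a).1 + (L.get b).2.1) = true
      · right
        refine ⟨if_pos hT, ?_⟩
        have h1 := hcol _ (List.get_mem L b)
        have h2 := allR_spec _ _ h1 _ (List.get_mem L a)
        change bor (Nat.beq (L.get a).1 (L.get b).1)
          (bor (Nat.ble (wt A P K ((L.get a).1 + (L.get b).2.1) + (L.get b).2.2 + 1)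
            (wt A P K ((L.get b).1 + (L.get b).2.1) + (L.get a).2.2))
          (!T ((L.get a).1 + (L.get b).2.1))) = true at h2
        rw [hT, Bool.not_true, bor_eq, bor_eq, Bool.or_false, Bool.or_eq_true] at h2
        rcases h2 with h2 | h2
        · exfalso
          have h2 := Nat.eq_of_beq_eq_true h2
          have hpw := List.pairwise_iff_get.1 (incr_spec L hinc)
          rcases lt_or_gt_of_ne hab with hlt | hlt
          · have := hpw a b hlt
            omega
          · have := hpw b a hlt
            omega
        · exact Nat.le_of_ble_eq_true h2
      · left
        exact if_neg hT
  · have := card_le_cnt (d - 1) (h * d - (2 * h + 2)) (2 * h + 2) 0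
    simp only [zero_add] at this
    exact this.trans hcnt

/-! ### The certificates -/

def cert14 : List Ent := [
  (0, 8224, 0)]

lemma cert14_col : cert14.all (okCol (suppT1 (nat_lit 2)) (nat_lit 2) (nat_lit 17) (nat_lit 1) cert14) = true := by
  decide +kernel

lemma cert14_cnt : cnt (4 - 1) (1 * 4 - (2 * 1 + 2)) (2 * 1 + 2) 0 ≤ cert14.length := by
  decide +kernel

lemma cert14_inc : incr cert14 = true := by decide +kernel

lemma cert14_ent : cert14.all (okEnt (suppT1 (nat_lit 2)) 1 4) = true := by decide +kernel

def cert15 : List Ent := [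
  (1, 770, 0), (16, 12320, 0), (256, 515, 0), (4096, 8240, 0)]

lemma cert15_col : cert15.all (okCol (suppT1 (nat_lit 3)) (nat_lit 15) (nat_lit 17) (nat_lit 1) cert15) = true := by
  decide +kernel

lemma cert15_cnt : cnt (5 - 1) (1 * 5 - (2 * 1 + 2)) (2 * 1 + 2) 0 ≤ cert15.length := by
  decide +kernel

lemma cert15_inc : incr cert15 = true := by decide +kernel

lemma cert15_ent : cert15.all (okEnt (suppT1 (nat_lit 3)) 1 5) = true := by decide +kernel

def cert17 : List Ent := [
  (3, 9472, 1), (18, 1297, 2), (33, 20497, 2), (48, 20992, 1),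
  (258, 9217, 1), (273, 16432, 0), (288, 20752, 1), (513, 8962, 0),
  (528, 20512, 1), (768, 8707, 0), (4098, 5377, 2), (4113, 12592, 0),
  (4128, 16912, 1), (4353, 12352, 0), (4368, 16672, 1), (4608, 8272, 1),
  (8193, 8512, 0), (8208, 12832, 0), (8448, 4432, 1), (12288, 8752, 0)]

lemma cert17_col : cert17.all (okCol (suppT1 (nat_lit 5)) (nat_lit 15) (nat_lit 17) (nat_lit 1) cert17) = true := by
  decide +kernel

lemma cert17_cnt : cnt (7 - 1) (1 * 7 - (2 * 1 + 2)) (2 * 1 + 2) 0 ≤ cert17.length := by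
  decide +kernel

lemma cert17_inc : incr cert17 = true := by decide +kernel

lemma cert17_ent : cert17.all (okEnt (suppT1 (nat_lit 5)) 1 7) = true := by decide +kernel

def cert23 : List Ent := [
  (0, 1118208, 0)]

lemma cert23_col : cert23.all (okCol (suppT2 (nat_lit 1)) (nat_lit 2) (nat_lit 17) (nat_lit 1) cert23) = true := by
  decide +kernel

lemma cert23_cnt : cnt (3 - 1) (2 * 3 - (2 * 2 + 2)) (2 * 2 + 2) 0 ≤ cert23.length := by
  decide +kernel

lemma cert23_inc : incr cert23 = true := by decide +kernel

lemma cert23_ent : cert23.all (okEnt (suppT2 (nat_lit 1)) 2 3) = true := by decide +kernel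

def cert24 : List Ent := [
  (2, 2166784, 0), (17, 1114384, 0), (32, 1114369, 0), (257, 1114144, 0),
  (272, 1114129, 0), (512, 8209, 0), (4097, 2162689, 0), (4112, 4609, 0),
  (4352, 1183744, 0), (8192, 1179904, 0), (65537, 1048864, 0), (65552, 1048849, 0),
  (65792, 1122304, 0), (69632, 1118464, 0), (131072, 1057024, 0), (1048577, 65824, 0),
  (1048592, 65809, 0), (1048832, 139264, 0), (1052672, 135424, 0), (1114112, 73984, 0),
  (2097152, 69634, 0)]

lemma cert24_col : cert24.all (okCol (suppT2 (nat_lit 2)) (nat_lit 23) (nat_lit 101) (nat_lit 1) cert24) = true := by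
  decide +kernel

lemma cert24_cnt : cnt (4 - 1) (2 * 4 - (2 * 2 + 2)) (2 * 2 + 2) 0 ≤ cert24.length := by
  decide +kernel

lemma cert24_inc : incr cert24 = true := by decide +kernel

lemma cert24_ent : cert24.all (okEnt (suppT2 (nat_lit 2)) 2 4) = true := by decide +kernel

def cert25 : List Ent := [
  (19, 3276800, 9), (34, 1114880, 11), (49, 135425, 0), (259, 197120, 10),
  (274, 3149840, 12), (289, 1114625, 14), (304, 135170, 0), (514, 1114400, 11),
  (529, 1114385, 4), (544, 1114370, 10), (769, 1114145, 9), (784, 3145745, 8),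
  (4099, 800, 0), (4114, 3146000, 3), (4129, 3145985, 9), (4144, 204800, 1),
  (4354, 3145760, 8), (4369, 131105, 9), (4384, 3145730, 1), (4609, 200720, 0),
  (4624, 200705, 0), (4864, 35, 0), (8194, 3150080, 0), (8209, 1183760, 1),
  (8224, 3215360, 11), (8449, 3149825, 3), (8464, 196865, 0), (8704, 196625, 0),
  (12289, 1179680, 0), (12304, 196640, 0), (12544, 196880, 0), (65539, 131840, 0),
  (65554, 1049360, 6), (65569, 1049345, 0), (65584, 143360, 0), (65794, 131585, 12),
  (65809, 1049105, 2), (65824, 1049090, 0), (66049, 131330, 2), (66064, 3211520, 4),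
  (66304, 131075, 3), (69634, 65840, 5), (69649, 1122320, 2), (69664, 139280, 11),
  (69889, 3211265, 3), (69904, 65570, 4), (70144, 135185, 0), (73729, 131600, 1),
  (73744, 1118225, 11), (73984, 131345, 0), (77824, 131120, 8), (131074, 4400, 12),
  (131089, 1060880, 12), (131104, 77840, 10), (131329, 66050, 12), (131344, 3146240, 9),
  (131584, 65795, 2), (135169, 305, 10), (135184, 73760, 2), (135424, 50, 0),
  (139264, 69680, 0), (196609, 770, 4), (196624, 12320, 2), (196864, 515, 2),
  (200704, 8240, 0), (1048579, 2228240, 5), (1048594, 2101520, 11), (1048609, 66305, 11),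
  (1048624, 2097155, 0), (1048834, 66080, 3), (1048849, 2101265, 12), (1048864, 2097665, 13),
  (1049089, 65825, 3), (1049104, 65810, 11), (1049344, 2097185, 7), (1052674, 2097440, 0),
  (1052689, 2097425, 10), (1052704, 2097410, 0), (1052929, 2228225, 8), (1052944, 2097170, 1),
  (1053184, 1122305, 0), (1056769, 135200, 0), (1056784, 2166800, 9), (1057024, 2101250, 0),
  (1060864, 2162720, 10), (1114114, 2162705, 13), (1114129, 785, 9), (1114144, 2109440, 5),
  (1114369, 545, 0), (1114384, 530, 4), (1114624, 2162960, 2), (1118209, 2162945, 2),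
  (1118224, 2105360, 0), (1118464, 2162690, 0), (1122304, 2101280, 0), (1179649, 2101505, 2),
  (1179664, 12305, 9), (1179904, 2097680, 9), (1183744, 8225, 0), (1245184, 2097920, 0),
  (2097154, 1052960, 8), (2097169, 1052945, 7), (2097184, 1052930, 5), (2097409, 1049120, 3),
  (2097424, 1052690, 3), (2097664, 1179920, 1), (2101249, 1048865, 0), (2101264, 1048850, 3),
  (2101504, 1048610, 2), (2105344, 1118240, 0), (2162689, 1114130, 0), (2162704, 1114115, 13),
  (2162944, 1114640, 0), (2166784, 1056800, 9), (2228224, 1048595, 5), (3145729, 4385, 13),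
  (3145744, 4370, 11), (3145984, 4130, 10), (3149824, 290, 1), (3211264, 65555, 3)]

lemma cert25_col : cert25.all (okCol (suppT2 (nat_lit 3)) (nat_lit 69) (nat_lit 101) (nat_lit 2) cert25) = true := by
  decide +kernel

lemma cert25_cnt : cnt (5 - 1) (2 * 5 - (2 * 2 + 2)) (2 * 2 + 2) 0 ≤ cert25.length := by
  decide +kernel

lemma cert25_inc : incr cert25 = true := by decide +kernel

lemma cert25_ent : cert25.all (okEnt (suppT2 (nat_lit 3)) 2 5) = true := by decide +kernel

def cert26 : List Ent := [
  (36, 3211536, 18), (51, 3211521, 172), (66, 9216, 280), (276, 3211296, 140),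
  (291, 3211281, 159), (306, 2163456, 300), (321, 8961, 168), (516, 1065216, 200),
  (531, 4194816, 135), (546, 2163216, 176), (561, 4198401, 276), (576, 8706, 137),
  (771, 1064961, 153), (786, 4194561, 232), (801, 1249296, 234), (816, 2162946, 239),
  (1026, 2162736, 227), (1041, 2162721, 219), (1056, 2162706, 233), (4116, 2236416, 174),
  (4131, 66576, 73), (4146, 4626, 181), (4161, 5121, 214), (4356, 1188096, 256),
  (4371, 66336, 81), (4386, 4896, 173), (4401, 4881, 278), (4416, 196866, 220),
  (4611, 1187841, 177), (4626, 4146, 167), (4641, 4194321, 179), (4656, 4194306, 257),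
  (4866, 2359296, 207), (4881, 4401, 145), (4896, 4386, 202), (5121, 4161, 167),
  (5136, 65571, 243), (8196, 1057536, 247), (8211, 2232321, 213), (8226, 2105376, 194),
  (8241, 2105361, 214), (8256, 2105346, 195), (8451, 1184001, 221), (8466, 2232336, 162),
  (8481, 1179921, 190), (8496, 1314816, 194), (8706, 576, 234), (8721, 3342336, 191),
  (8736, 4325376, 251), (8961, 321, 183), (8976, 2228496, 122), (9216, 66, 143),
  (12291, 1053441, 214), (12306, 2101296, 239), (12321, 2101281, 113), (12336, 1310976, 240),
  (12546, 1179906, 211), (12561, 2228241, 141), (12576, 1310736, 160), (12801, 1179651, 214),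
  (12816, 4198416, 23), (13056, 1052676, 188), (16386, 2097216, 253), (16401, 2097201, 39),
  (16416, 2097186, 97), (16641, 1049091, 149), (16656, 4194576, 73), (16896, 1048836, 129),
  (65556, 2174976, 182), (65571, 5136, 143), (65586, 2098176, 195), (65601, 2228736, 158),
  (65796, 1126656, 197), (65811, 82176, 200), (65826, 2097936, 249), (65841, 2097921, 190),
  (65856, 2228481, 82), (66051, 4259841, 259), (66066, 2097696, 223), (66081, 2097681, 227),
  (66096, 2097666, 186), (66306, 2097456, 198), (66321, 2097441, 186), (66336, 4371, 291),
  (66561, 3158016, 213), (66576, 4131, 182), (69636, 1122816, 237), (69651, 2170881, 206),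
  (69666, 2171136, 171), (69681, 1180416, 181), (69696, 197376, 156), (69891, 3150081, 179),
  (69906, 2170896, 153), (69921, 1180176, 172), (69936, 1253376, 187), (70146, 1122306, 187),
  (70161, 1179936, 206), (70176, 4263936, 259), (70401, 3154176, 108), (70416, 1179681, 235),
  (70656, 3153921, 225), (73731, 2166801, 277), (73746, 2166786, 267), (73761, 2167041, 148),
  (73776, 1249536, 154), (73986, 1118466, 243), (74001, 3277056, 218), (74016, 4260096, 259),
  (74241, 1118211, 179), (74256, 4259856, 198), (74496, 2162976, 147), (77826, 1245201, 243),
  (77841, 2162691, 163), (77856, 1245456, 174), (78081, 1114371, 155), (78096, 1245216, 168),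
  (78336, 3146241, 188), (81921, 2293761, 7), (81936, 3211776, 0), (82176, 65811, 7),
  (131076, 3280896, 250), (131091, 2109441, 140), (131106, 2109696, 158), (131121, 1118976, 171),
  (131136, 2097411, 200), (131331, 1061121, 170), (131346, 2109456, 115), (131361, 1118736, 153),
  (131376, 1118721, 225), (131586, 2232576, 178), (131601, 3219456, 187), (131616, 4202496, 217),
  (131841, 1179666, 154), (131856, 1118241, 206), (132096, 1118256, 144), (135171, 3276801, 242),
  (135186, 2105616, 223), (135201, 2105601, 146), (135216, 1115136, 245), (135426, 1057026, 174),
  (135441, 3215616, 203), (135456, 4198656, 273), (135681, 3215376, 177), (135696, 1052706, 160),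
  (135936, 1114161, 159), (139266, 2101266, 266), (139281, 2101521, 240), (139296, 1184016, 211),
  (139521, 1052931, 100), (139536, 1183776, 209), (139776, 4194336, 196), (143361, 2097171, 338),
  (143376, 2097156, 231), (143616, 1179696, 124), (147456, 2228226, 79), (196611, 3215361, 204),
  (196626, 1126401, 144), (196641, 1053456, 128), (196656, 1053696, 186), (196866, 4416, 113),
  (196881, 1053216, 164), (196896, 1126416, 185), (197121, 3153936, 191), (197136, 1052961, 247),
  (197376, 69696, 207), (200706, 3211266, 264), (200721, 3150336, 194), (200736, 1122576, 205),
  (200961, 3150096, 195), (200976, 1122336, 168), (201216, 3149841, 162), (204801, 1118226, 247),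
  (204816, 1118496, 210), (205056, 3146001, 178), (208896, 1114131, 238), (262146, 2113536, 276),
  (262161, 1060866, 63), (262176, 1061136, 111), (262401, 2101761, 109), (262416, 1060896, 102),
  (262656, 2101506, 144), (266241, 3145731, 211), (266256, 1057056, 183), (266496, 1056816, 172),
  (270336, 1052691, 202), (1048596, 1191936, 151), (1048611, 2162961, 147), (1048626, 1064976, 315),
  (1048641, 1245696, 193), (1048836, 16896, 302), (1048851, 3146496, 139), (1048866, 1114896, 205),
  (1048881, 1114881, 236), (1048896, 1245441, 119), (1049091, 16641, 180), (1049106, 1114656, 210),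
  (1049121, 1114641, 252), (1049136, 1114626, 228), (1049346, 1114416, 193), (1049361, 1114401, 195),
  (1049376, 1114386, 242), (1049601, 3145746, 220), (1049616, 1114146, 168), (1052676, 13056, 289),
  (1052691, 270336, 196), (1052706, 135696, 217), (1052721, 1060881, 229), (1052736, 3149826, 120),
  (1052931, 139521, 264), (1052946, 3146016, 171), (1052961, 197136, 188), (1052976, 3145986, 239),
  (1053186, 3145776, 241), (1053201, 3145761, 244), (1053216, 196881, 266), (1053441, 12291, 173),
  (1053456, 196641, 235), (1053696, 196656, 162), (1056771, 1183761, 277), (1056786, 1183746, 251),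
  (1056801, 1056801, 182), (1056816, 266496, 218), (1057026, 135426, 207), (1057041, 2294016, 218),
  (1057056, 266256, 258), (1057281, 2293776, 185), (1057296, 3276816, 149), (1057536, 8196, 183),
  (1060866, 262161, 350), (1060881, 1052721, 233), (1060896, 262416, 233), (1061121, 131331, 257),
  (1061136, 262176, 290), (1061376, 2163201, 209), (1064961, 771, 267), (1064976, 1048626, 133),
  (1065216, 516, 111), (1114116, 2297856, 278), (1114131, 208896, 204), (1114146, 1049616, 210),
  (1114161, 135936, 271), (1114176, 1180161, 141), (1114371, 78081, 255), (1114386, 1049376, 156),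
  (1114401, 1049361, 264), (1114416, 1049346, 263), (1114626, 1049136, 223), (1114641, 1049121, 182),
  (1114656, 1049106, 254), (1114881, 1048881, 204), (1114896, 1048866, 173), (1115136, 135216, 167),
  (1118211, 74241, 276), (1118226, 204801, 206), (1118241, 131856, 219), (1118256, 132096, 282),
  (1118466, 73986, 209), (1118481, 1122321, 215), (1118496, 204816, 243), (1118721, 131376, 207),
  (1118736, 131361, 217), (1118976, 131121, 199), (1122306, 70146, 268), (1122321, 1118481, 210),
  (1122336, 200976, 274), (1122561, 2102016, 290), (1122576, 200736, 200), (1122816, 69636, 216),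
  (1126401, 196626, 251), (1126416, 196896, 267), (1126656, 65796, 196), (1130496, 1245186, 10),
  (1179651, 12801, 257), (1179666, 131841, 137), (1179681, 70416, 182), (1179696, 143616, 289),
  (1179906, 12546, 180), (1179921, 8481, 197), (1179936, 70161, 214), (1180161, 1114176, 192),
  (1180176, 69921, 231), (1180416, 69681, 183), (1183746, 1056786, 222), (1183761, 1056771, 194),
  (1183776, 139536, 234), (1184001, 8451, 178), (1184016, 139296, 235), (1184256, 3149856, 239),
  (1187841, 4611, 250), (1187856, 3146256, 246), (1188096, 4356, 202), (1191936, 1048596, 238),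
  (1245186, 1130496, 274), (1245201, 77826, 228), (1245216, 78096, 288), (1245441, 1048896, 245),
  (1245456, 77856, 174), (1245696, 1048641, 203), (1249281, 2101776, 197), (1249296, 801, 191),
  (1249536, 73776, 262), (1253376, 69936, 215), (1310721, 2101251, 192), (1310736, 12576, 174),
  (1310976, 12336, 157), (1314816, 8496, 247), (2097156, 143376, 231), (2097171, 143361, 148),
  (2097186, 16416, 260), (2097201, 16401, 226), (2097216, 16386, 177), (2097411, 131136, 170),
  (2097426, 2101536, 181), (2097441, 66321, 271), (2097456, 66306, 231), (2097666, 66096, 237),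
  (2097681, 66081, 179), (2097696, 66066, 237), (2097921, 65841, 210), (2097936, 65826, 240),
  (2098176, 65586, 264), (2101251, 1310721, 253), (2101266, 139266, 205), (2101281, 12321, 223),
  (2101296, 12306, 174), (2101506, 262656, 235), (2101521, 139281, 151), (2101536, 2097426, 254),
  (2101761, 262401, 250), (2101776, 1249281, 239), (2102016, 1122561, 136), (2105346, 8256, 262),
  (2105361, 8241, 245), (2105376, 8226, 268), (2105601, 135201, 166), (2105616, 135186, 201),
  (2105856, 2228256, 220), (2109441, 131091, 249), (2109456, 131346, 279), (2109696, 131106, 171),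
  (2113536, 262146, 180), (2162691, 77841, 285), (2162706, 1056, 259), (2162721, 1041, 215),
  (2162736, 1026, 168), (2162946, 816, 214), (2162961, 1048611, 252), (2162976, 74496, 261),
  (2163201, 1061376, 207), (2163216, 546, 271), (2163456, 306, 129), (2166786, 73746, 208),
  (2166801, 73731, 194), (2166816, 2167296, 187), (2167041, 73761, 203), (2167056, 2167056, 201),
  (2167296, 2166816, 302), (2170881, 69651, 226), (2170896, 69906, 235), (2171136, 69666, 251),
  (2174976, 65556, 205), (2228226, 147456, 258), (2228241, 12561, 217), (2228256, 2105856, 266),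
  (2228481, 65856, 197), (2228496, 8976, 284), (2228736, 65601, 237), (2232321, 8211, 258),
  (2232336, 8466, 241), (2232576, 131586, 236), (2236416, 4116, 218), (2293761, 81921, 268),
  (2293776, 1057281, 162), (2294016, 1057041, 212), (2297856, 1114116, 211), (2359296, 4866, 207),
  (3145731, 266241, 268), (3145746, 1049601, 189), (3145761, 1053201, 208), (3145776, 1053186, 192),
  (3145986, 1052976, 201), (3146001, 205056, 272), (3146016, 1052946, 275), (3146241, 78336, 235),
  (3146256, 1187856, 230), (3146496, 1048851, 214), (3149826, 1052736, 260), (3149841, 201216, 168),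
  (3149856, 1184256, 219), (3150081, 69891, 280), (3150096, 200961, 242), (3150336, 200721, 240),
  (3153921, 70656, 204), (3153936, 197121, 227), (3154176, 70401, 282), (3158016, 66561, 105),
  (3211266, 200706, 174), (3211281, 291, 252), (3211296, 276, 256), (3211521, 51, 242),
  (3211536, 36, 244), (3211776, 81936, 216), (3215361, 196611, 284), (3215376, 135681, 210),
  (3215616, 135441, 241), (3219456, 131601, 218), (3276801, 135171, 157), (3276816, 1057296, 256),
  (3277056, 74001, 214), (3280896, 131076, 230), (3342336, 8721, 241), (4194306, 4656, 197),
  (4194321, 4641, 180), (4194336, 139776, 290), (4194561, 786, 179), (4194576, 16656, 265),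
  (4194816, 531, 276), (4198401, 561, 138), (4198416, 12816, 317), (4198656, 135456, 173),
  (4202496, 131616, 126), (4259841, 66051, 90), (4259856, 74256, 195), (4260096, 74016, 92),
  (4263936, 70176, 158), (4325376, 8736, 70)]

lemma cert26_col0 : ((cert26.drop 0).take 71).all
    (okCol (suppT2 (nat_lit 4)) (nat_lit 73) (nat_lit 1009) (nat_lit 3) cert26) = true := by
  decide +kernel

lemma cert26_col1 : ((cert26.drop 71).take 71).all
    (okCol (suppT2 (nat_lit 4)) (nat_lit 73) (nat_lit 1009) (nat_lit 3) cert26) = true := by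
  decide +kernel

lemma cert26_col2 : ((cert26.drop 142).take 71).all
    (okCol (suppT2 (nat_lit 4)) (nat_lit 73) (nat_lit 1009) (nat_lit 3) cert26) = true := by
  decide +kernel

lemma cert26_col3 : ((cert26.drop 213).take 71).all
    (okCol (suppT2 (nat_lit 4)) (nat_lit 73) (nat_lit 1009) (nat_lit 3) cert26) = true := by
  decide +kernel

lemma cert26_col4 : ((cert26.drop 284).take 71).all
    (okCol (suppT2 (nat_lit 4)) (nat_lit 73) (nat_lit 1009) (nat_lit 3) cert26) = true := by
  decide +kernel

lemma cert26_col5 : ((cert26.drop 355).take 71).all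
    (okCol (suppT2 (nat_lit 4)) (nat_lit 73) (nat_lit 1009) (nat_lit 3) cert26) = true := by
  decide +kernel

lemma cert26_col : cert26.all (okCol (suppT2 (nat_lit 4)) (nat_lit 73) (nat_lit 1009) (nat_lit 3) cert26) = true :=
  all_chunk _ cert26 0 71 cert26_col0 <|
  all_chunk _ cert26 71 71 cert26_col1 <|
  all_chunk _ cert26 142 71 cert26_col2 <|
  all_chunk _ cert26 213 71 cert26_col3 <|
  all_chunk _ cert26 284 71 cert26_col4 <|
  all_chunk _ cert26 355 71 cert26_col5 <|
  (by decide +kernel : (cert26.drop 426).all _ = true)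

lemma cert26_cnt : cnt (6 - 1) (2 * 6 - (2 * 2 + 2)) (2 * 2 + 2) 0 ≤ cert26.length := by
  decide +kernel

lemma cert26_inc : incr cert26 = true := by decide +kernel

lemma cert26_ent : cert26.all (okEnt (suppT2 (nat_lit 4)) 2 6) = true := by decide +kernel

/-- For `(n,d)` in the list `(2,4), (2,5), (2,7), (4,3), (4,4), (4,5), (4,6)` (encoded by
`h = n/2`), there is a `ℤ`-linear combination of the period vectors `p^{a,b}` of the linear
cycles whose period matrix has the maximal possible rank
`min{#I_d, #I_{(n/2)d−n−2}}`; i.e. the Fermat variety has a general Hodge cycle. -/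
theorem exists_general_hodge_cycle (h d : ℕ)
    (hin : (h = 1 ∧ (d = 4 ∨ d = 5 ∨ d = 7)) ∨ (h = 2 ∧ (d = 3 ∨ d = 4 ∨ d = 5 ∨ d = 6))) :
    ∃ c : (Fin (h + 1) → Fin d) × Equiv.Perm (Fin (2 * h + 2)) → ℤ,
      (pmat h d (fun i =>
          ∑ ab : (Fin (h + 1) → Fin d) × Equiv.Perm (Fin (2 * h + 2)),
            (c ab : ℂ) * pvec h d (fun e => ((ab.1 e : ℕ))) ab.2 i)).rank
        = min (Fintype.card (IdxSet h d d))
            (Fintype.card (IdxSet h d (h * d - (2 * h + 2)))) := by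
  rcases hin with ⟨rfl, rfl | rfl | rfl⟩ | ⟨rfl, rfl | rfl | rfl | rfl⟩
  · exact certificate _ 1 4 _ _ _ cert14 (by norm_num) (by norm_num) (supp1 4) cert14_cnt
      cert14_inc cert14_ent cert14_col
  · exact certificate _ 1 5 _ _ _ cert15 (by norm_num) (by norm_num) (supp1 5) cert15_cnt
      cert15_inc cert15_ent cert15_col
  · exact certificate _ 1 7 _ _ _ cert17 (by norm_num) (by norm_num) (supp1 7) cert17_cnt
      cert17_inc cert17_ent cert17_col
  · exact certificate _ 2 3 _ _ _ cert23 (by norm_num) (by norm_num) (supp2 3) cert23_cnt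
      cert23_inc cert23_ent cert23_col
  · exact certificate _ 2 4 _ _ _ cert24 (by norm_num) (by norm_num) (supp2 4) cert24_cnt
      cert24_inc cert24_ent cert24_col
  · exact certificate _ 2 5 _ _ _ cert25 (by norm_num) (by norm_num) (supp2 5) cert25_cnt
      cert25_inc cert25_ent cert25_col
  · exact certificate _ 2 6 _ _ _ cert26 (by norm_num) (by norm_num) (supp2 6) cert26_cnt
      cert26_inc cert26_ent cert26_col
end
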